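/- arXiv:2506.12151 — 2 statements merged into one kernel-verified Lean document; each statement's English description precedes it below -/
import Mathlib

section
/- Fix a positive integer N and, for each i ∈ {1, …, N}, a sequence {T_n^{(i)}}_{n≥1} of finite simple graphs with at least one vertex. Then there exist integers k > j ≥ 2 such that for every i ∈ {1, …, N}, it is NOT the case that (t(C_{2j}, T_n^{(i)}) ∈ (0,1) and t(C_{2k}, T_n^{(i)}) > 0 for all sufficiently large n, and the ratio log t(C_{2k}, T_n^{(i)}) / log t(C_{2j}, T_n^{(i)}) converges to C(C_{2k}, C_{2j}) = 4k(k−1)/(4kj−2k−2j) as n → ∞). -/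
open SimpleGraph

/-- The homomorphism density `t(G,T)`. -/
noncomputable def homDensity {α β : Type*} [Fintype α] [Fintype β]
    (G : SimpleGraph α) (T : SimpleGraph β) : ℝ :=
  (Nat.card (G →g T) : ℝ) / (Fintype.card β : ℝ) ^ (Fintype.card α)
/-- The set of real exponents `c ≥ 0` such that `t(G,T) ≥ t(H,T)^c` for all
finite graphs `T` with at least one vertex. -/
def domSet {α β : Type*} [Fintype α] [Fintype β]
    (G : SimpleGraph α) (H : SimpleGraph β) : Set ℝ :=
  {c : ℝ | 0 ≤ c ∧ ∀ (n : ℕ), 0 < n → ∀ T : SimpleGraph (Fin n),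
    homDensity H T ^ c ≤ homDensity G T}

/-- The homomorphism density domination exponent `C(G,H)`, as the infimum of `domSet G H`. -/
noncomputable def domExp {α β : Type*} [Fintype α] [Fintype β]
    (G : SimpleGraph α) (H : SimpleGraph β) : ℝ :=
  sInf (domSet G H)

open Matrix

/-! ### Cycle homomorphisms and traces -/

lemma pow_apply_eq_sum {V : Type*} [Fintype V] [DecidableEq V] (A : Matrix V V ℝ) (n : ℕ) :
    ∀ u v, (A ^ (n+1)) u v =
      ∑ f : Fin n → V, ∏ i : Fin (n+1),
        A ((Fin.cons u f : Fin (n+1) → V) i) ((Fin.snoc f v : Fin (n+1) → V) i) := by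
  induction n with
  | zero => intro u v; simp [Fin.snoc]
  | succ n ih =>
    intro u v
    rw [pow_succ', Matrix.mul_apply, ← (Fin.consEquiv (fun _ : Fin (n+1) => V)).sum_comp,
      Fintype.sum_prod_type]
    refine Finset.sum_congr rfl fun w _ => ?_
    rw [ih, Finset.mul_sum]
    refine Finset.sum_congr rfl fun f _ => ?_
    rw [Fin.prod_univ_succ (n := n+1)]
    have h : (Fin.snoc ((Fin.consEquiv (fun _ : Fin (n+1) => V)) (w, f)) v : Fin (n+2) → V)
        = Fin.cons w (Fin.snoc f v : Fin (n+1) → V) := by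
      rw [Fin.cons_snoc_eq_snoc_cons]; rfl
    rw [h]
    simp [Fin.consEquiv]

lemma trace_pow_eq_sum {V : Type*} [Fintype V] [DecidableEq V] (A : Matrix V V ℝ) (n : ℕ) :
    (A ^ (n+1)).trace = ∑ f : Fin (n+1) → V, ∏ i : Fin (n+1), A (f i) (f (i+1)) := by
  rw [← (Fin.consEquiv (fun _ : Fin (n+1) => V)).sum_comp, Fintype.sum_prod_type, Matrix.trace]
  refine Finset.sum_congr rfl fun u _ => ?_
  rw [Matrix.diag_apply, pow_apply_eq_sum]
  refine Finset.sum_congr rfl fun f _ => ?_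
  refine Finset.prod_congr rfl fun i _ => ?_
  congr 1
  refine Fin.lastCases ?_ (fun j => ?_) i
  · simp [Fin.consEquiv]
  · simp [Fin.consEquiv, Fin.coeSucc_eq_succ]

lemma card_hom_cycle {V : Type*} [Fintype V] [DecidableEq V] (T : SimpleGraph V)
    [DecidableRel T.Adj] (n : ℕ) :
    (Nat.card (cycleGraph (n+2) →g T) : ℝ) = ((T.adjMatrix ℝ) ^ (n+2)).trace := by
  rw [trace_pow_eq_sum]
  have h1 : ∀ f : Fin (n+2) → V, ∏ i : Fin (n+2), T.adjMatrix ℝ (f i) (f (i+1)) =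
      if (∀ i, T.Adj (f i) (f (i+1))) then 1 else 0 := by
    intro f
    simp only [SimpleGraph.adjMatrix_apply, Finset.prod_ite_zero]
    simp
  simp only [h1, Finset.sum_boole]
  norm_cast
  rw [← Fintype.card_subtype, ← Nat.card_eq_fintype_card]
  refine Nat.card_congr ⟨fun f => ⟨f, fun i => f.map_rel (by rw [cycleGraph_adj]; right; simp)⟩,
    fun f => ⟨f.1, ?_⟩, fun f => rfl, fun f => rfl⟩
  intro a b hab
  rw [cycleGraph_adj] at hab
  rcases hab with h | h
  · have : a = b + 1 := by rw [← h]; abel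
    subst this; exact (f.2 b).symm
  · have : b = a + 1 := by rw [← h]; abel
    subst this; exact f.2 a

lemma spectral_facts {V : Type*} [Fintype V] [DecidableEq V] [Nonempty V] (T : SimpleGraph V)
    [DecidableRel T.Adj] :
    ∃ l w : V → ℝ, (∀ i, 0 ≤ w i) ∧ ∑ i, w i = 1 ∧
      (∀ m, ((T.adjMatrix ℝ) ^ m).trace = ∑ i, l i ^ m) ∧
      ((T.adjMatrix ℝ) ^ 2).trace = Fintype.card V * ∑ i, w i * l i := by
  have hA : (T.adjMatrix ℝ).IsHermitian := by
    rw [Matrix.IsHermitian, Matrix.conjTranspose_eq_transpose_of_trivial]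
    exact T.isSymm_adjMatrix
  set A := T.adjMatrix ℝ with hAdef
  set U : Matrix V V ℝ := (hA.eigenvectorUnitary : Matrix V V ℝ) with hU
  set l := hA.eigenvalues with hl
  have hUU : U * star U = 1 := Unitary.mul_star_self_of_mem hA.eigenvectorUnitary.2
  have hUU' : star U * U = 1 := Unitary.star_mul_self_of_mem hA.eigenvectorUnitary.2
  have hsp : A = U * Matrix.diagonal l * star U := by
    have := hA.spectral_theorem
    rw [Unitary.conjStarAlgAut_apply] at this
    exact this
  have hpow : ∀ m, A ^ m = U * Matrix.diagonal (l ^ m) * star U := by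
    intro m
    rw [← Matrix.diagonal_pow]
    induction m with
    | zero => simp [hUU]
    | succ m ih =>
      rw [pow_succ, ih]
      conv_lhs => rw [hsp]
      calc _ = U * Matrix.diagonal l ^ m * (star U * U) * Matrix.diagonal l * star U := by
            simp only [mul_assoc]
        _ = _ := by rw [hUU', mul_one, pow_succ]; simp only [mul_assoc]
  set v : V → ℝ := star U *ᵥ (fun _ => 1) with hv
  have hquad : ∀ d : V → ℝ, (fun _ => (1:ℝ)) ⬝ᵥ ((U * Matrix.diagonal d * star U) *ᵥ (fun _ => 1))
      = ∑ i, v i ^ 2 * d i := by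
    intro d
    rw [← Matrix.mulVec_mulVec, ← Matrix.mulVec_mulVec, Matrix.dotProduct_mulVec]
    have : (fun _ => (1:ℝ)) ᵥ* U = v := by
      rw [hv, Matrix.star_eq_conjTranspose, Matrix.conjTranspose_eq_transpose_of_trivial,
        Matrix.mulVec_transpose]
    rw [this, dotProduct]
    refine Finset.sum_congr rfl fun i _ => ?_
    rw [← hv, Matrix.mulVec_diagonal]; ring
  have hn : (0:ℝ) < Fintype.card V := by exact_mod_cast Fintype.card_pos
  have hv1 : ∑ i, v i ^ 2 = Fintype.card V := by
    have := hquad (fun _ => 1)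
    rw [Matrix.diagonal_one, mul_one, hUU, Matrix.one_mulVec] at this
    simp only [mul_one] at this
    rw [← this]; simp [dotProduct]
  refine ⟨l, fun i => v i ^ 2 / Fintype.card V, fun i => by positivity, ?_, ?_, ?_⟩
  · rw [← Finset.sum_div, hv1, div_self hn.ne']
  · intro m
    rw [hpow, Matrix.trace_mul_cycle, hUU', one_mul, Matrix.trace_diagonal]
    rfl
  · have h2 : (A ^ 2).trace = (fun _ => (1:ℝ)) ⬝ᵥ (A *ᵥ (fun _ => 1)) := by
      rw [pow_two, Matrix.trace, dotProduct]
      refine Finset.sum_congr rfl fun i _ => ?_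
      rw [Matrix.diag_apply, hAdef, SimpleGraph.adjMatrix_mul_self_apply_self]
      have := T.adjMatrix_mulVec_const_apply (α := ℝ) (a := 1) (v := i)
      change (T.adjMatrix ℝ *ᵥ fun _ => 1) i = _ at this
      rw [this, one_mul, mul_one]
    rw [h2]
    conv_lhs => rw [hsp]
    rw [hquad, Finset.mul_sum]
    refine Finset.sum_congr rfl fun i _ => ?_
    field_simp

lemma key_ineq {V : Type*} [Fintype V] [Nonempty V] (T : SimpleGraph V) :
    ∃ s : ℝ, 0 ≤ s ∧ ∀ k : ℕ, 3 ≤ k →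
      s ^ (2*k) ≤ homDensity (cycleGraph (2*k)) T ∧
      homDensity (cycleGraph (2*2)) T ^ (k-1) ≤ s ^ (k-2) * homDensity (cycleGraph (2*k)) T := by
  classical
  obtain ⟨l, w, hw, hw1, htr, h2⟩ := spectral_facts T
  have hn : (0:ℝ) < Fintype.card V := by exact_mod_cast Fintype.card_pos
  set n : ℝ := (Fintype.card V : ℝ) with hndef
  set r : V → ℝ := fun i => l i / n with hr
  have hd : ∀ k : ℕ, 1 ≤ k → homDensity (cycleGraph (2*k)) T = ∑ i, r i ^ (2*k) := by
    intro k hk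
    obtain ⟨m, rfl⟩ : ∃ m, k = m + 1 := ⟨k-1, by omega⟩
    have : 2*(m+1) = 2*m+2 := by ring
    rw [homDensity, this, card_hom_cycle, htr, Fintype.card_fin, Finset.sum_div]
    simp [hr, div_pow, hndef]
  have hs : ∑ i, r i ^ 2 = ∑ i, w i * r i := by
    rw [htr] at h2
    simp only [hr, div_pow, ← Finset.sum_div, h2, mul_div_assoc']
    field_simp
  refine ⟨∑ i, r i ^ 2, by positivity, fun k hk => ?_⟩
  rw [hd k (by omega), hd 2 (by omega)]
  have hwle : ∀ i, w i ≤ 1 := fun i => hw1 ▸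
    Finset.single_le_sum (fun i _ => hw i) (Finset.mem_univ i)
  constructor
  · rw [hs]
    refine (Real.pow_arith_mean_le_arith_mean_pow_of_even _ w r (fun i _ => hw i) hw1
      (even_two_mul k)).trans ?_
    refine Finset.sum_le_sum fun i _ => ?_
    have : 0 ≤ r i ^ (2*k) := by rw [pow_mul]; positivity
    nlinarith [hwle i]
  · set s := ∑ i, r i ^ 2 with hsdef
    have hs0 : 0 ≤ s := by positivity
    rcases hs0.eq_or_lt with h0 | h0
    · have hz : ∀ i, r i = 0 := by
        intro i
        have := (Finset.sum_eq_zero_iff_of_nonneg (fun i _ => sq_nonneg (r i))).1 h0.symm i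
          (Finset.mem_univ i)
        simpa using this
      have h1 : k - 1 ≠ 0 := by omega
      have h2 : k ≠ 0 := by omega
      simp [hz, h1, h2]
    · have hj := Real.pow_arith_mean_le_arith_mean_pow Finset.univ (fun i => r i ^ 2 / s)
        (fun i => r i ^ 2) (fun i _ => by positivity) (by rw [← Finset.sum_div, div_self h0.ne'])
        (fun i _ => by positivity) (k-1)
      have e1 : ∑ i, r i ^ 2 / s * r i ^ 2 = (∑ i, r i ^ (2*2)) / s := by
        rw [Finset.sum_div]; refine Finset.sum_congr rfl fun i _ => ?_
        ring
      have e2 : ∑ i, r i ^ 2 / s * (r i ^ 2)^(k-1) = (∑ i, r i ^ (2*k)) / s := by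
        rw [Finset.sum_div]; refine Finset.sum_congr rfl fun i _ => ?_
        obtain ⟨m, rfl⟩ : ∃ m, k = m + 1 := ⟨k-1, by omega⟩
        simp only [Nat.add_sub_cancel]
        ring
      rw [e1, e2, div_pow, div_le_div_iff₀ (by positivity) h0] at hj
      have e3 : s ^ (k-1) = s^(k-2) * s := by rw [← pow_succ]; congr 1; omega
      rw [e3] at hj
      refine le_of_mul_le_mul_right (hj.trans (le_of_eq ?_)) h0
      ring

/-! ### The Bose–Chowla sum graph -/

lemma exists_perm_of_multiset {F : Type*} [DecidableEq F] {k : ℕ} (a b : Fin k → F)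
    (h : Multiset.map a Finset.univ.val = Multiset.map b Finset.univ.val) :
    ∃ σ : Equiv.Perm (Fin k), b = a ∘ σ := by
  have hc : ∀ x, Nonempty ({i // b i = x} ≃ {i // a i = x}) := by
    intro x
    refine ⟨Fintype.equivOfCardEq ?_⟩
    have := congrArg (Multiset.count x) h
    rw [Multiset.count_map, Multiset.count_map] at this
    rw [Fintype.card_subtype, Fintype.card_subtype, Finset.card_def, Finset.card_def]
    simp only [Finset.filter_val]
    simpa [eq_comm] using this.symm
  have e := fun x => (hc x).some
  refine ⟨(Equiv.sigmaFiberEquiv b).symm.trans ((Equiv.sigmaCongrRight e).trans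
    (Equiv.sigmaFiberEquiv a)), ?_⟩
  funext i
  exact ((e (b i)) ⟨i, rfl⟩).2.symm

lemma bose_chowla (p k : ℕ) [Fact p.Prime] (hk : 2 ≤ k) :
    ∃ g : ZMod p → (GaloisField p k)ˣ, Function.Injective g ∧
      ∀ a b : Fin k → ZMod p, ∏ i, g (a i) = ∏ i, g (b i) →
        ∃ σ : Equiv.Perm (Fin k), b = a ∘ σ := by
  obtain ⟨θ, hθ⟩ := Field.exists_primitive_element (ZMod p) (GaloisField p k)
  rw [Field.primitive_element_iff_minpoly_natDegree_eq, GaloisField.finrank p (by omega)] at hθ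
  have hne : ∀ a : ZMod p, θ - algebraMap _ _ a ≠ 0 := by
    intro a h
    rw [sub_eq_zero] at h
    rw [h, minpoly.eq_X_sub_C, Polynomial.natDegree_X_sub_C] at hθ
    omega
  refine ⟨fun a => Units.mk0 _ (hne a), ?_, ?_⟩
  · intro a b h
    have := congrArg Units.val h
    simp only [Units.val_mk0, sub_right_inj] at this
    exact (algebraMap (ZMod p) (GaloisField p k)).injective this
  · intro a b h
    have h := congrArg Units.val h
    simp only [Units.coe_prod, Units.val_mk0] at h
    let P : (Fin k → ZMod p) → Polynomial (ZMod p) :=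
      fun a => ∏ i, (Polynomial.X - Polynomial.C (a i))
    have hP : ∀ a, Polynomial.aeval θ (P a) = ∏ i, (θ - algebraMap _ _ (a i)) := by
      intro a; simp [P, map_prod]
    have hm : ∀ a, (P a).Monic := fun a =>
      Polynomial.monic_prod_of_monic _ _ fun i _ => Polynomial.monic_X_sub_C _
    have hdeg : ∀ a, (P a).degree = k := by
      intro a
      simp [P, Polynomial.degree_prod]
    have hroots : ∀ a, (P a).roots = Multiset.map a Finset.univ.val := by
      intro a
      rw [← Polynomial.roots_multiset_prod_X_sub_C (Multiset.map a Finset.univ.val),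
        Multiset.map_map]
      rfl
    have heq : P a = P b := by
      by_contra hab
      have hsub : P a - P b ≠ 0 := sub_ne_zero.2 hab
      have h0 : Polynomial.aeval θ (P a - P b) = 0 := by
        rw [map_sub, hP, hP, h, sub_self]
      have hd := Polynomial.degree_sub_lt_left ((hdeg a).trans (hdeg b).symm) (hm a).ne_zero
        ((hm a).leadingCoeff.trans (hm b).leadingCoeff.symm)
      have hd2 := Polynomial.degree_le_of_dvd (minpoly.dvd _ _ h0) hsub
      rw [hdeg] at hd
      have hd3 : (minpoly (ZMod p) θ).degree = k := by
        rw [Polynomial.degree_eq_natDegree, hθ]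
        exact minpoly.ne_zero (Algebra.IsIntegral.isIntegral θ)
      rw [hd3] at hd2
      exact absurd (hd2.trans_lt hd) (lt_irrefl _)
    apply exists_perm_of_multiset
    rw [← hroots, ← hroots, heq]

/-- The sum graph of `g`. -/
def sumGraph {F G : Type*} [CommGroup G] (g : F → G) : SimpleGraph G where
  Adj u v := u ≠ v ∧ ∃ a, u * v = g a
  symm := ⟨fun u v h => ⟨h.1.symm, by obtain ⟨a, ha⟩ := h.2; exact ⟨a, by rw [mul_comm, ha]⟩⟩⟩
  loopless := ⟨fun u h => h.1 rfl⟩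

lemma sumGraph_upper {F G : Type*} [CommGroup G] [Fintype G] [Fintype F] (g : F → G)
    (m : ℕ)
    (hB : ∀ a b : Fin (m+1) → F, ∏ i, g (a i) = ∏ i, g (b i) →
        ∃ σ : Equiv.Perm (Fin (m+1)), b = a ∘ σ) :
    Nat.card (cycleGraph (2*(m+1)) →g sumGraph g) ≤
      Fintype.card G * (Fintype.card F ^ (m+1) * (m+1).factorial) := by
  classical
  have hstep : ∀ (f : cycleGraph (2*m+2) →g sumGraph g) (i : Fin (2*m+2)),
      ∃ a, f i * f (i+1) = g a := fun f i =>
    (f.map_rel (a := i) (b := i+1) (by rw [cycleGraph_adj]; right; simp)).2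
  choose s hs using hstep
  let ev : Fin (m+1) → Fin (2*m+2) := fun i => ⟨2*i, by omega⟩
  have hprod : ∀ h : Fin (2*m+2) → G, ∏ i, h i = ∏ i : Fin (m+1), h (ev i) * h (ev i + 1) := by
    intro h
    have e : Fin (m+1) × Fin 2 ≃ Fin (2*m+2) :=
      finProdFinEquiv.trans (finCongr (by ring))
    rw [← (finProdFinEquiv.trans (finCongr (by ring)) : Fin (m+1) × Fin 2 ≃ Fin (2*m+2)).prod_comp,
      Fintype.prod_prod_type]
    refine Finset.prod_congr rfl fun i _ => ?_
    rw [Fin.prod_univ_two]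
    congr 2
    · ext; simp [ev, finProdFinEquiv]
    · ext; simp [ev, finProdFinEquiv, Fin.val_add]
      rw [Nat.mod_eq_of_lt] <;> omega
  have key : ∀ f : cycleGraph (2*m+2) →g sumGraph g, ∃ σ : Equiv.Perm (Fin (m+1)),
      (fun i => s f (ev i + 1)) = (fun i => s f (ev i)) ∘ σ := by
    intro f
    apply hB
    simp only [← hs]
    rw [← hprod (fun i => f i), ← hprod (fun i => f (i+1))]
    exact (Equiv.prod_comp (Equiv.addRight (1 : Fin (2*m+2))) (fun i => f i)).symm
  choose σ hσ using key
  let Φ : (cycleGraph (2*m+2) →g sumGraph g) → G × ((Fin (m+1) → F) × Equiv.Perm (Fin (m+1))) :=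
    fun f => (f 0, fun i => s f (ev i), σ f)
  have hinj : Function.Injective Φ := by
    intro f f' h
    simp only [Φ, Prod.mk.injEq] at h
    obtain ⟨h0, h1, h2⟩ := h
    have h3 : ∀ i, s f (ev i + 1) = s f' (ev i + 1) := by
      have := hσ f
      rw [h1, h2, ← hσ f'] at this
      exact fun i => congrFun this i
    have h4 : ∀ i, s f i = s f' i := by
      intro i
      rcases Nat.even_or_odd' i.val with ⟨c, hc | hc⟩
      · have : i = ev ⟨c, by omega⟩ := by ext; simp [ev, hc]
        rw [this]; exact congrFun h1 _
      · have : i = ev ⟨c, by omega⟩ + 1 := by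
          ext; simp [ev, Fin.val_add, hc]
          rw [Nat.mod_eq_of_lt]; omega
        rw [this]; exact h3 _
    ext i
    refine Fin.induction (motive := fun i => f i = f' i) h0 (fun j hj => ?_) i
    have e1 := hs f j.castSucc
    have e2 := hs f' j.castSucc
    rw [h4, ← e2, hj, Fin.coeSucc_eq_succ] at e1
    exact mul_left_cancel e1
  have := Nat.card_le_card_of_injective Φ hinj
  have e : 2*(m+1) = 2*m+2 := by ring
  rw [e]
  refine this.trans (le_of_eq ?_)
  simp [Nat.card_eq_fintype_card, Fintype.card_perm]

lemma sumGraph_lower {F G : Type*} [CommGroup G] [Fintype G] [Fintype F] (g : F → G)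
    (hg : Function.Injective g) (hF : 1 ≤ Fintype.card F) :
    (Fintype.card G : ℝ) * ((Fintype.card F : ℝ) - 1) ^ 2 ≤
    (Nat.card (cycleGraph (2*2) →g sumGraph g) : ℝ) := by
  classical
  have hF' : (0:ℝ) ≤ (Fintype.card F : ℝ) - 1 := by
    rw [sub_nonneg]; exact_mod_cast hF
  have hdeg : ∀ u, (Fintype.card F : ℝ) - 1 ≤ ((sumGraph g).degree u : ℝ) := by
    intro u
    have : (Finset.univ.image (fun a => u⁻¹ * g a)).erase u ⊆ (sumGraph g).neighborFinset u := by
      intro v hv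
      simp only [Finset.mem_erase, Finset.mem_image, Finset.mem_univ, true_and] at hv
      obtain ⟨h1, a, rfl⟩ := hv
      rw [SimpleGraph.mem_neighborFinset]
      exact ⟨h1.symm, a, by simp⟩
    have h2 := Finset.card_le_card this
    have h3 := Finset.pred_card_le_card_erase (s := Finset.univ.image (fun a => u⁻¹ * g a)) (a := u)
    rw [Finset.card_image_of_injective _ (fun a b h => hg (mul_left_cancel h)),
      Finset.card_univ] at h3
    rw [SimpleGraph.card_neighborFinset_eq_degree] at h2
    rw [sub_le_iff_le_add]
    exact_mod_cast (by omega : Fintype.card F ≤ (sumGraph g).degree u + 1)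
  have := card_hom_cycle (sumGraph g) 2
  rw [show 2*2 = 2+2 from rfl, this]
  set A := (sumGraph g).adjMatrix ℝ with hA
  have hsym : ∀ u v, (A*A) u v = (A*A) v u := by
    intro u v
    have : (A*A).transpose = A*A := by
      rw [Matrix.transpose_mul, hA, SimpleGraph.transpose_adjMatrix]
    conv_lhs => rw [← this]
    rfl
  have h4 : A ^ (2+2) = (A*A)*(A*A) := by rw [pow_add, pow_two]
  rw [h4, Matrix.trace]
  calc _ = ∑ u : G, ((Fintype.card F : ℝ) - 1) ^ 2 := by simp
    _ ≤ _ := by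
      refine Finset.sum_le_sum fun u _ => ?_
      rw [Matrix.diag_apply, Matrix.mul_apply]
      refine le_trans ?_ (Finset.single_le_sum (f := fun v => (A*A) u v * (A*A) v u)
        (fun v _ => ?_) (Finset.mem_univ u))
      · simp only [hA, SimpleGraph.adjMatrix_mul_self_apply_self]
        nlinarith [hdeg u]
      · change 0 ≤ (A*A : Matrix G G ℝ) u v * (A*A : Matrix G G ℝ) v u
        rw [hsym v u]; exact mul_self_nonneg _

/-! ### The domination exponent -/

lemma homDensity_iso {α V W : Type*} [Fintype α] [Fintype V] [Fintype W] (G : SimpleGraph α)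
    (T : SimpleGraph V) (T' : SimpleGraph W) (e : T ≃g T') : homDensity G T = homDensity G T' := by
  have h1 : Nat.card (G →g T) = Nat.card (G →g T') := Nat.card_congr
    ⟨fun f => e.toHom.comp f, fun f => e.symm.toHom.comp f,
      fun f => by ext x; simp, fun f => by ext x; simp⟩
  rw [homDensity, homDensity, h1, Fintype.card_congr e.toEquiv]

lemma domSet_apply {α β V : Type*} [Fintype α] [Fintype β] [Fintype V] [Nonempty V]
    {G : SimpleGraph α} {H : SimpleGraph β} {c : ℝ} (hc : c ∈ domSet G H) (T : SimpleGraph V) :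
    homDensity H T ^ c ≤ homDensity G T := by
  let e := (Fintype.equivFin V).symm
  have := hc.2 (Fintype.card V) Fintype.card_pos (T.comap e)
  rwa [homDensity_iso _ _ _ (SimpleGraph.Iso.comap e T),
    homDensity_iso _ _ _ (SimpleGraph.Iso.comap e T)] at this

/-- The exponent. -/
noncomputable def cexp (k : ℕ) : ℝ := 2 * (k:ℝ) * ((k:ℝ) - 1) / (3 * (k:ℝ) - 2)

lemma log_ineq {V : Type*} [Fintype V] [Nonempty V] (T : SimpleGraph V) :
    ∃ x : ℝ, ∀ k : ℕ, 3 ≤ k → 0 < homDensity (cycleGraph (2*2)) T →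
      0 < homDensity (cycleGraph (2*k)) T ∧
      2 * (k:ℝ) * x ≤ Real.log (homDensity (cycleGraph (2*k)) T) ∧
      ((k:ℝ) - 1) * Real.log (homDensity (cycleGraph (2*2)) T) ≤
        ((k:ℝ) - 2) * x + Real.log (homDensity (cycleGraph (2*k)) T) := by
  obtain ⟨s, hs, h⟩ := key_ineq T
  refine ⟨Real.log s, fun k hk h2 => ?_⟩
  obtain ⟨ha, hb⟩ := h k hk
  have hs0 : 0 < s := by
    rcases hs.eq_or_lt with h0 | h0
    · rw [← h0, zero_pow (by omega), zero_mul] at hb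
      exact absurd hb (not_le.2 (by positivity))
    · exact h0
  have htk : 0 < homDensity (cycleGraph (2*k)) T := lt_of_lt_of_le (by positivity) ha
  refine ⟨htk, ?_, ?_⟩
  · have := Real.log_le_log (by positivity) ha
    rw [Real.log_pow] at this
    push_cast at this
    exact this
  · have := Real.log_le_log (by positivity) hb
    rw [Real.log_mul (by positivity) htk.ne', Real.log_pow, Real.log_pow,
      Nat.cast_sub (by omega), Nat.cast_sub (by omega)] at this
    push_cast at this
    exact this

lemma cexp_mem (k : ℕ) (hk : 3 ≤ k) :
    cexp k ∈ domSet (cycleGraph (2*k)) (cycleGraph (2*2)) := by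
  have hk' : (3:ℝ) ≤ k := by exact_mod_cast hk
  have hc : 0 < cexp k := by
    rw [cexp]; apply div_pos <;> nlinarith
  refine ⟨hc.le, fun n hn T => ?_⟩
  have : Nonempty (Fin n) := ⟨⟨0, hn⟩⟩
  have hnn : ∀ m, 0 ≤ homDensity (cycleGraph m) T := fun m => by
    rw [homDensity]; positivity
  rcases (hnn (2*2)).eq_or_lt with h0 | h0
  · rw [← h0, Real.zero_rpow hc.ne']; exact hnn _
  obtain ⟨x, hx⟩ := log_ineq T
  obtain ⟨h1, h2, h3⟩ := hx k hk h0
  rw [← Real.log_le_log_iff (by positivity) h1, Real.log_rpow h0, cexp, div_mul_eq_mul_div,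
    div_le_iff₀ (by linarith)]
  nlinarith

lemma le_of_mem_domSet (k : ℕ) (hk : 3 ≤ k) (c : ℝ)
    (hc : c ∈ domSet (cycleGraph (2*k)) (cycleGraph (2*2))) : cexp k ≤ c := by
  have hk' : (3:ℝ) ≤ k := by exact_mod_cast hk
  have hc0 : 0 ≤ c := hc.1
  set M : ℝ := k.factorial * 2 ^ (2*k-1) with hM
  have hMpos : 0 < M := by positivity
  -- the inequality for each prime
  have main : ∀ p : ℕ, p.Prime →
      2 * (k:ℝ) * ((k:ℝ) - 1) * Real.log p - Real.log M ≤
        c * (Real.log 4 + (3 * (k:ℝ) - 2) * Real.log p) := by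
    intro p hp
    have : Fact p.Prime := ⟨hp⟩
    obtain ⟨g, hg, hB⟩ := bose_chowla p k (by omega)
    have : Fintype (GaloisField p k)ˣ := Fintype.ofFinite _
    have hp2 : (2:ℝ) ≤ p := by exact_mod_cast hp.two_le
    have hcardG : (Fintype.card (GaloisField p k)ˣ : ℝ) = (p:ℝ) ^ k - 1 := by
      rw [← Nat.card_eq_fintype_card, Nat.card_units, GaloisField.card p k (by omega),
        Nat.cast_sub (Nat.one_le_pow _ _ hp.pos)]
      push_cast; ring
    have hcardF : Fintype.card (ZMod p) = p := ZMod.card p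
    have hlow := sumGraph_lower g hg (by rw [hcardF]; exact hp.one_le)
    have hup : (Nat.card (cycleGraph (2*k) →g sumGraph g) : ℝ) ≤
        Fintype.card (GaloisField p k)ˣ * ((p:ℝ) ^ k * k.factorial) := by
      obtain ⟨m, rfl⟩ : ∃ m, k = m + 1 := ⟨k-1, by omega⟩
      have := sumGraph_upper g m hB
      rw [hcardF] at this
      exact_mod_cast this
    have hdom := domSet_apply hc (sumGraph g)
    have hpk : (2:ℝ) ≤ (p:ℝ) ^ k := by
      calc (2:ℝ) ≤ p := hp2
        _ ≤ (p:ℝ) ^ k := le_self_pow₀ (by linarith) (by omega)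
    rw [hcardF] at hlow
    set m : ℝ := (Fintype.card (GaloisField p k)ˣ : ℝ) with hm
    have hm1 : (p:ℝ)^k / 2 ≤ m := by rw [hcardG]; linarith
    have hm2 : m ≤ (p:ℝ)^k := by rw [hcardG]; linarith
    have hppos : (0:ℝ) < p := by linarith
    have hmpos : 0 < m := lt_of_lt_of_le (by positivity) hm1
    have hL : ((p:ℝ)^2 / 4) / ((p:ℝ)^k)^3 ≤ homDensity (cycleGraph (2*2)) (sumGraph g) := by
      rw [homDensity, ← hm, Fintype.card_fin]
      calc ((p:ℝ)^2 / 4) / ((p:ℝ)^k)^3 ≤ ((p:ℝ)-1)^2 / m^3 := by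
            gcongr
            nlinarith
        _ = (m * ((p:ℝ)-1)^2) / m^(2*2) := by field_simp
        _ ≤ _ := by gcongr
    have hU : homDensity (cycleGraph (2*k)) (sumGraph g) ≤
        M * (p:ℝ)^k / ((p:ℝ)^k)^(2*k-1) := by
      rw [homDensity, ← hm, Fintype.card_fin]
      have e : m ^ (2*k) = m ^ (2*k-1) * m := by rw [← pow_succ]; congr 1; omega
      calc _ ≤ m * ((p:ℝ) ^ k * k.factorial) / m ^ (2*k) := by gcongr
        _ = ((p:ℝ) ^ k * k.factorial) / m ^ (2*k-1) := by rw [e]; field_simp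
        _ ≤ ((p:ℝ) ^ k * k.factorial) / ((p:ℝ)^k / 2) ^ (2*k-1) := by gcongr
        _ = _ := by rw [hM, div_pow]; field_simp
    have hfin := (Real.rpow_le_rpow (by positivity) hL hc0).trans (hdom.trans hU)
    have hlog := Real.log_le_log (by positivity) hfin
    rw [Real.log_rpow (by positivity), Real.log_div (by positivity) (by positivity),
      Real.log_div (by positivity) (by positivity), Real.log_div (by positivity) (by positivity),
      Real.log_mul (by positivity) (by positivity)] at hlog
    simp only [Real.log_pow] at hlog
    rw [Nat.cast_sub (by omega)] at hlog
    push_cast at hlog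
    linarith
  by_contra hlt
  rw [not_le, cexp, lt_div_iff₀ (by linarith)] at hlt
  set d := 2 * (k:ℝ) * ((k:ℝ) - 1) - c * (3 * (k:ℝ) - 2) with hd
  have hdpos : 0 < d := by rw [hd]; linarith
  have hb : ∀ p : ℕ, p.Prime → Real.log p ≤ (c * Real.log 4 + Real.log M) / d := by
    intro p hp
    rw [le_div_iff₀ hdpos, hd]
    have := main p hp
    linarith
  obtain ⟨n, hn⟩ := exists_nat_gt (Real.exp ((c * Real.log 4 + Real.log M) / d))
  obtain ⟨p, hpn, hp⟩ := Nat.exists_infinite_primes n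
  have h1 := hb p hp
  have hp0 : (0:ℝ) < p := by exact_mod_cast hp.pos
  rw [Real.log_le_iff_le_exp hp0] at h1
  have : (n:ℝ) ≤ p := by exact_mod_cast hpn
  linarith

lemma domExp_eq (k : ℕ) (hk : 3 ≤ k) :
    domExp (cycleGraph (2*k)) (cycleGraph (2*2)) = cexp k := by
  apply le_antisymm
  · exact csInf_le ⟨0, fun c hc => hc.1⟩ (cexp_mem k hk)
  · exact le_csInf ⟨_, cexp_mem k hk⟩ (fun c hc => le_of_mem_domSet k hk c hc)

theorem stmt_4 (N : ℕ) (hN : 0 < N)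
    (V : Fin N → ℕ → ℕ) (hV : ∀ i n, 0 < V i n)
    (T : ∀ (i : Fin N) (n : ℕ), SimpleGraph (Fin (V i n))) :
    ∃ k j : ℕ, 2 ≤ j ∧ j < k ∧
      domExp (cycleGraph (2*k)) (cycleGraph (2*j)) =
        (4*(k:ℝ)*((k:ℝ)-1)) / (4*(k:ℝ)*(j:ℝ) - 2*(k:ℝ) - 2*(j:ℝ)) ∧
      ∀ i : Fin N,
        ¬((∀ᶠ n in Filter.atTop,
              homDensity (cycleGraph (2*j)) (T i n) ∈ Set.Ioo (0:ℝ) 1 ∧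
              0 < homDensity (cycleGraph (2*k)) (T i n)) ∧
          Filter.Tendsto
            (fun n => Real.log (homDensity (cycleGraph (2*k)) (T i n)) /
                      Real.log (homDensity (cycleGraph (2*j)) (T i n)))
            Filter.atTop
            (nhds (domExp (cycleGraph (2*k)) (cycleGraph (2*j))))) := by
  by_contra hcon
  have hne : ∀ i n, Nonempty (Fin (V i n)) := fun i n => ⟨⟨0, hV i n⟩⟩
  choose x hx using fun i n => (haveI := hne i n; log_ineq (T i n))
  -- each `k` is tight for some sequence, which pins the limit of `x / log t(C_4)`
  have hall : ∀ r : ℕ, ∃ i : Fin N, Filter.Tendsto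
      (fun n => x i n / Real.log (homDensity (cycleGraph (2*2)) (T i n))) Filter.atTop
      (nhds (cexp (r+3) / (2 * ((r+3 : ℕ) : ℝ)))) := by
    intro r
    by_contra hno
    apply hcon
    have hk : 3 ≤ r + 3 := by omega
    generalize r + 3 = k at hk hno
    have hk' : (3:ℝ) ≤ k := by exact_mod_cast hk
    refine ⟨k, 2, le_rfl, by omega, ?_, ?_⟩
    · rw [domExp_eq k hk, cexp, div_eq_div_iff (by linarith) (by push_cast; linarith)]
      push_cast; ring
    · rintro i ⟨hev, hlim⟩
      apply hno
      refine ⟨i, ?_⟩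
      rw [domExp_eq k hk] at hlim
      have hlo := hlim.div_const (2 * (k:ℝ))
      have hhi := ((tendsto_const_nhds (x := (k:ℝ) - 1)).sub hlim).div_const ((k:ℝ) - 2)
      have hval : ((k:ℝ) - 1 - cexp k) / ((k:ℝ) - 2) = cexp k / (2 * (k:ℝ)) := by
        have h1 : (3:ℝ) * k - 2 ≠ 0 := by linarith
        have h2 : (k:ℝ) - 2 ≠ 0 := by linarith
        have h3 : cexp k * (3 * (k:ℝ) - 2) = 2 * (k:ℝ) * ((k:ℝ) - 1) := by
          rw [cexp, div_mul_cancel₀ _ h1]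
        rw [div_eq_div_iff h2 (by positivity)]
        linarith
      rw [hval] at hhi
      refine tendsto_of_tendsto_of_tendsto_of_le_of_le' hlo hhi ?_ ?_
      · filter_upwards [hev] with n hn
        obtain ⟨h1, h2, h3⟩ := hx i n k hk hn.1.1
        have hneg := Real.log_neg hn.1.1 hn.1.2
        rw [← sub_nonneg]
        have e : x i n / Real.log (homDensity (cycleGraph (2*2)) (T i n)) -
            Real.log (homDensity (cycleGraph (2*k)) (T i n)) /
              Real.log (homDensity (cycleGraph (2*2)) (T i n)) / (2 * (k:ℝ)) =
            (2 * (k:ℝ) * x i n - Real.log (homDensity (cycleGraph (2*k)) (T i n))) /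
              (2 * (k:ℝ) * Real.log (homDensity (cycleGraph (2*2)) (T i n))) := by
          have := hneg.ne
          field_simp
        rw [e]
        exact div_nonneg_of_nonpos (by linarith) (by nlinarith)
      · filter_upwards [hev] with n hn
        obtain ⟨h1, h2, h3⟩ := hx i n k hk hn.1.1
        have hneg := Real.log_neg hn.1.1 hn.1.2
        rw [← sub_nonneg]
        have e : ((k:ℝ) - 1 - Real.log (homDensity (cycleGraph (2*k)) (T i n)) /
              Real.log (homDensity (cycleGraph (2*2)) (T i n))) / ((k:ℝ) - 2) -
            x i n / Real.log (homDensity (cycleGraph (2*2)) (T i n)) =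
            (((k:ℝ) - 1) * Real.log (homDensity (cycleGraph (2*2)) (T i n)) -
              (((k:ℝ) - 2) * x i n + Real.log (homDensity (cycleGraph (2*k)) (T i n)))) /
              (((k:ℝ) - 2) * Real.log (homDensity (cycleGraph (2*2)) (T i n))) := by
          have := hneg.ne
          have h2 : (k:ℝ) - 2 ≠ 0 := by linarith
          field_simp
          ring
        rw [e]
        exact div_nonneg_of_nonpos (by linarith) (by nlinarith)
  choose f hf using hall
  obtain ⟨a, b, hab, hfab⟩ := Finite.exists_ne_map_eq_of_infinite f
  have h1 := hf a
  rw [hfab] at h1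
  have h2 := tendsto_nhds_unique h1 (hf b)
  apply hab
  have ha : (0:ℝ) ≤ a := Nat.cast_nonneg a
  have hb : (0:ℝ) ≤ b := Nat.cast_nonneg b
  rw [cexp, cexp, div_div, div_div, div_eq_div_iff (by push_cast; nlinarith) (by push_cast; nlinarith)] at h2
  push_cast at h2
  have h3 : (((a:ℝ) + 3) * ((b:ℝ) + 3)) * ((a:ℝ) - b) = 0 := by linarith
  have h4 : (((a:ℝ) + 3) * ((b:ℝ) + 3)) ≠ 0 := by positivity
  have h5 := (mul_eq_zero.1 h3).resolve_left h4
  exact_mod_cast sub_eq_zero.1 h5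
end

section
/- Let k, ℓ ≥ 1 be integers. Then C(P_k, P_ℓ) = k/ℓ if k > ℓ and either k is even or both k and ℓ are odd; C(P_k, P_ℓ) = (k+1)/ℓ if k is odd and ℓ is even; C(P_k, P_ℓ) = (k+1)/(ℓ+1) if k < ℓ and k is even; and C(P_k, P_ℓ) = (k+ℓ−r)/((a+1)ℓ) if k < ℓ and both k and ℓ are odd, where a = ⌊ℓ/(k+1)⌋ and r = ℓ − a(k+1) is the remainder of dividing ℓ by k+1. -/
open SimpleGraph

section Walks

set_option linter.unusedSectionVars false

variable {V : Type*} [Fintype V]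

open Classical in
/-- adjacency indicator -/
noncomputable def adjI (T : SimpleGraph V) (u v : V) : ℝ := if T.Adj u v then 1 else 0

/-- number of walks with `m` edges from `v`. -/
noncomputable def aW (T : SimpleGraph V) : ℕ → V → ℝ
  | 0, _ => 1
  | m+1, v => ∑ u, adjI T v u * aW T m u

/-- number of walks with `m` edges. -/
noncomputable def wW (T : SimpleGraph V) (m : ℕ) : ℝ := ∑ v, aW T m v

lemma adjI_symm (T : SimpleGraph V) (u v : V) : adjI T u v = adjI T v u := by
  by_cases h : T.Adj u v
  · simp [adjI, h, h.symm]
  · have h2 : ¬ T.Adj v u := fun hc => h hc.symm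
    simp [adjI, h, h2]

lemma adjI_nonneg (T : SimpleGraph V) (u v : V) : 0 ≤ adjI T u v := by
  unfold adjI; split_ifs <;> norm_num

lemma adjI_le_one (T : SimpleGraph V) (u v : V) : adjI T u v ≤ 1 := by
  unfold adjI; split_ifs <;> norm_num

lemma aW_nonneg (T : SimpleGraph V) (m : ℕ) (v : V) : 0 ≤ aW T m v := by
  induction m generalizing v with
  | zero => simp [aW]
  | succ m ih => exact Finset.sum_nonneg fun u _ => mul_nonneg (adjI_nonneg _ _ _) (ih u)

lemma aW_pos (T : SimpleGraph V) (m : ℕ) {u v : V} (h : T.Adj u v) : 0 < aW T m u := by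
  induction m generalizing u v with
  | zero => simp [aW]
  | succ m ih =>
    rw [aW]
    refine Finset.sum_pos' (fun x _ => mul_nonneg (adjI_nonneg _ _ _) (aW_nonneg _ _ _)) ⟨v, Finset.mem_univ _, ?_⟩
    have : adjI T u v = 1 := by simp [adjI, h]
    rw [this, one_mul]; exact ih h.symm

/-- functional form of the path homomorphism count -/
noncomputable def sP (T : SimpleGraph V) (m : ℕ) (f : Fin (m+1) → V) : ℝ :=
  ∏ i : Fin m, adjI T (f i.castSucc) (f i.succ)

lemma sum_sP (T : SimpleGraph V) (m : ℕ) (v : V) :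
    ∑ g : Fin m → V, sP T m (Fin.cons v g : Fin (m+1) → V) = aW T m v := by
  induction m generalizing v with
  | zero => simp [sP, aW]
  | succ m ih =>
    rw [← (Fin.consEquiv (fun _ => V)).sum_comp, Fintype.sum_prod_type, aW]
    refine Finset.sum_congr rfl fun u _ => ?_
    rw [← ih u, Finset.mul_sum]
    refine Finset.sum_congr rfl fun g _ => ?_
    unfold sP
    rw [Fin.prod_univ_succ]
    simp [Fin.consEquiv]

lemma sum_sP_all (T : SimpleGraph V) (m : ℕ) :
    ∑ f : Fin (m+1) → V, sP T m f = wW T m := by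
  rw [← (Fin.consEquiv (fun _ => V)).sum_comp, Fintype.sum_prod_type, wW]
  exact Finset.sum_congr rfl fun u _ => sum_sP T m u

lemma hom_iff (T : SimpleGraph V) (m : ℕ) (f : Fin (m+1) → V) :
    (∀ {a b}, (pathGraph (m+1)).Adj a b → T.Adj (f a) (f b)) ↔
      ∀ i : Fin m, T.Adj (f i.castSucc) (f i.succ) := by
  constructor
  · intro h i
    apply h
    rw [pathGraph_adj]; left; simp
  · intro h a b hab
    rw [pathGraph_adj] at hab
    rcases hab with hab | hab
    · have := h ⟨a, by omega⟩
      rwa [show b = Fin.succ ⟨a, by omega⟩ from Fin.ext (by simp [hab])]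
    · have := (h ⟨b, by omega⟩).symm
      rwa [show a = Fin.succ ⟨b, by omega⟩ from Fin.ext (by simp [hab])]

lemma card_hom (T : SimpleGraph V) (m : ℕ) :
    (Nat.card (pathGraph (m+1) →g T) : ℝ) = wW T m := by
  classical
  rw [← sum_sP_all]
  have e : (pathGraph (m+1) →g T) ≃
      {f : Fin (m+1) → V // ∀ i : Fin m, T.Adj (f i.castSucc) (f i.succ)} :=
    { toFun := fun f => ⟨f, (hom_iff T m f).1 (fun h => f.map_rel h)⟩
      invFun := fun f => ⟨f.1, fun h => (hom_iff T m f.1).2 f.2 h⟩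
      left_inv := fun f => rfl
      right_inv := fun f => rfl }
  rw [Nat.card_congr e, Nat.card_eq_fintype_card, Fintype.card_subtype, Finset.card_filter]
  push_cast
  refine Finset.sum_congr rfl fun f _ => ?_
  unfold sP adjI
  rw [Finset.prod_ite_zero]
  simp

lemma wW_add (T : SimpleGraph V) (i j : ℕ) : wW T (i + j) = ∑ v, aW T i v * aW T j v := by
  induction i generalizing j with
  | zero => simp [wW, aW]
  | succ i ih =>
    rw [show i + 1 + j = i + (j+1) by ring, ih]
    simp only [aW, Finset.mul_sum, Finset.sum_mul]
    rw [Finset.sum_comm]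
    refine Finset.sum_congr rfl fun u _ => Finset.sum_congr rfl fun v _ => ?_
    rw [adjI_symm]; ring

lemma wW_add_one (T : SimpleGraph V) (i j : ℕ) :
    wW T (i + j + 1) = ∑ u, ∑ v, adjI T u v * (aW T i u * aW T j v) := by
  rw [show i + j + 1 = i + (j+1) by ring, wW_add]
  simp only [aW, Finset.mul_sum]
  refine Finset.sum_congr rfl fun u _ => Finset.sum_congr rfl fun v _ => ?_
  ring

lemma wW_split (T : SimpleGraph V) (i j : ℕ) : wW T (i + j + 1) ≤ wW T i * wW T j := by
  rw [wW_add_one, wW, wW, Finset.sum_mul_sum]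
  refine Finset.sum_le_sum fun u _ => Finset.sum_le_sum fun v _ => ?_
  have := mul_nonneg (aW_nonneg T i u) (aW_nonneg T j v)
  nlinarith [adjI_le_one T u v]

lemma wW_cs (T : SimpleGraph V) (i j : ℕ) : wW T (i + j) ^ 2 ≤ wW T (2*i) * wW T (2*j) := by
  rw [two_mul, two_mul, wW_add, wW_add, wW_add]
  have := Finset.sum_mul_sq_le_sq_mul_sq Finset.univ (aW T i) (aW T j)
  simpa [sq] using this

lemma wW_zero (T : SimpleGraph V) : wW T 0 = Fintype.card V := by simp [wW, aW]

lemma wW_pos (T : SimpleGraph V) (m : ℕ) {u v : V} (h : T.Adj u v) : 0 < wW T m :=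
  Finset.sum_pos' (fun _ _ => aW_nonneg _ _ _) ⟨u, Finset.mem_univ _, aW_pos T m h⟩

lemma gibbs {ι : Type*} (s : Finset ι) (q x : ι → ℝ) (hq : ∀ i ∈ s, 0 ≤ q i)
    (hx : ∀ i ∈ s, 0 ≤ x i) (hqx : ∀ i ∈ s, q i ≠ 0 → 0 < x i) (hQ : 0 < ∑ i ∈ s, q i)
    (hX : 0 < ∑ i ∈ s, x i) :
    ∑ i ∈ s, q i * (Real.log (x i) - Real.log (q i)) ≤
      (∑ i ∈ s, q i) * (Real.log (∑ i ∈ s, x i) - Real.log (∑ i ∈ s, q i)) := by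
  set Q := ∑ i ∈ s, q i with hQd
  set X := ∑ i ∈ s, x i with hXd
  have key : ∀ i ∈ s, q i * (Real.log (x i) - Real.log (q i)) ≤
      q i * (Real.log X - Real.log Q) + (x i * (Q / X) - q i) := by
    intro i hi
    by_cases h0 : q i = 0
    · rw [h0]; have := hx i hi; simp; positivity
    · have hqi : 0 < q i := lt_of_le_of_ne (hq i hi) (Ne.symm h0)
      have hxi := hqx i hi h0
      have h1 := Real.log_le_sub_one_of_pos (show 0 < x i * Q / (q i * X) by positivity)
      rw [Real.log_div (by positivity) (by positivity), Real.log_mul hxi.ne' hQ.ne',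
        Real.log_mul h0 hX.ne'] at h1
      have h2 := mul_le_mul_of_nonneg_left h1 hqi.le
      have h3 : q i * (x i * Q / (q i * X) - 1) = x i * (Q / X) - q i := by field_simp
      rw [h3] at h2
      nlinarith
  calc _ ≤ ∑ i ∈ s, (q i * (Real.log X - Real.log Q) + (x i * (Q / X) - q i)) :=
        Finset.sum_le_sum key
    _ = _ := by
        rw [Finset.sum_add_distrib, Finset.sum_sub_distrib, ← Finset.sum_mul, ← Finset.sum_mul,
          ← hQd, ← hXd]
        field_simp; ring

noncomputable def gW (T : SimpleGraph V) (i j : ℕ) : ℝ :=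
  ∑ v, aW T i v * aW T j v * (Real.log (aW T i v) - Real.log (aW T j v))

lemma entropy_step (T : SimpleGraph V) {a b : V} (h : T.Adj a b) (s t : ℕ) :
    gW T (s+1) t - gW T s (t+1) ≤
      wW T (s+t+1) * (Real.log (wW T (s+t+3)) - Real.log (wW T (s+t+1))) := by
  have hq : wW T (s+t+1) = ∑ p : V × V, adjI T p.1 p.2 * (aW T t p.1 * aW T s p.2) := by
    rw [Fintype.sum_prod_type, add_comm s t, wW_add_one]
  have hx : wW T (s+t+3) = ∑ p : V × V, adjI T p.1 p.2 * (aW T (s+1) p.1 * aW T (t+1) p.2) := by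
    rw [Fintype.sum_prod_type, show s+t+3 = (s+1)+(t+1)+1 by ring, wW_add_one]
  have hn : ∀ i j (p : V × V), 0 ≤ adjI T p.1 p.2 * (aW T i p.1 * aW T j p.2) := fun i j p =>
    mul_nonneg (adjI_nonneg _ _ _) (mul_nonneg (aW_nonneg _ _ _) (aW_nonneg _ _ _))
  have g := gibbs Finset.univ (fun p : V × V => adjI T p.1 p.2 * (aW T t p.1 * aW T s p.2))
    (fun p : V × V => adjI T p.1 p.2 * (aW T (s+1) p.1 * aW T (t+1) p.2))
    (fun p _ => hn _ _ p) (fun p _ => hn _ _ p) (by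
      intro p _ hp
      have hadj : T.Adj p.1 p.2 := by
        by_contra hc; apply hp; simp [adjI, hc]
      have : adjI T p.1 p.2 = 1 := by simp [adjI, hadj]
      simp only [this, one_mul]
      exact mul_pos (aW_pos T _ hadj) (aW_pos T _ hadj.symm))
    (by rw [← hq]; exact wW_pos T _ h) (by rw [← hx]; exact wW_pos T _ h)
  rw [← hq, ← hx] at g
  refine le_trans (le_of_eq ?_) g
  have hterm : ∀ p : V × V, adjI T p.1 p.2 * (aW T t p.1 * aW T s p.2) *
      (Real.log (adjI T p.1 p.2 * (aW T (s+1) p.1 * aW T (t+1) p.2)) -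
        Real.log (adjI T p.1 p.2 * (aW T t p.1 * aW T s p.2))) =
      adjI T p.1 p.2 * aW T s p.2 * (aW T t p.1 * (Real.log (aW T (s+1) p.1) - Real.log (aW T t p.1)))
      + adjI T p.2 p.1 * aW T t p.1 * (aW T s p.2 * (Real.log (aW T (t+1) p.2) - Real.log (aW T s p.2))) := by
    intro p
    by_cases hadj : T.Adj p.1 p.2
    · have h1 : adjI T p.1 p.2 = 1 := by simp [adjI, hadj]
      have h2 : adjI T p.2 p.1 = 1 := by simp [adjI, hadj.symm]
      have := fun m => (aW_pos T m hadj).ne'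
      have := fun m => (aW_pos T m hadj.symm).ne'
      rw [h1, h2, one_mul, one_mul, Real.log_mul (by simp_all) (by simp_all),
        Real.log_mul (by simp_all) (by simp_all)]
      ring
    · have h1 : adjI T p.1 p.2 = 0 := by simp [adjI, hadj]
      have h2 : adjI T p.2 p.1 = 0 := by rw [adjI_symm, h1]
      simp [h1, h2]
  rw [Finset.sum_congr rfl fun p _ => hterm p, Finset.sum_add_distrib, sub_eq_add_neg]
  congr 1
  · rw [Fintype.sum_prod_type, gW]
    refine Finset.sum_congr rfl fun u _ => ?_
    simp only
    rw [← Finset.sum_mul]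
    simp only [aW]; ring
  · rw [Fintype.sum_prod_type_right, gW, ← Finset.sum_neg_distrib]
    refine Finset.sum_congr rfl fun u _ => ?_
    simp only
    rw [← Finset.sum_mul]
    simp only [aW]; ring

lemma entropy_two (T : SimpleGraph V) {a b : V} (h : T.Adj a b) (l : ℕ) :
    2 * (Real.log (wW T l) - Real.log (wW T 0)) ≤
      l * (Real.log (wW T (l+2)) - Real.log (wW T l)) := by
  have hw := wW_pos T l h
  have tel : gW T l 0 - gW T 0 l ≤
      l * (wW T l * (Real.log (wW T (l+2)) - Real.log (wW T l))) := by
    have h1 : ∀ s ∈ Finset.range l, gW T (s+1) (l-(s+1)) - gW T s (l - s) ≤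
        wW T l * (Real.log (wW T (l+2)) - Real.log (wW T l)) := by
      intro s hs
      rw [Finset.mem_range] at hs
      obtain ⟨t, rfl⟩ : ∃ t, l = s + t + 1 := ⟨l - s - 1, by omega⟩
      have := entropy_step T h s t
      rwa [show s + t + 1 - (s+1) = t by omega, show s + t + 1 - s = t + 1 by omega]
    have h2 := Finset.sum_le_sum h1
    rw [Finset.sum_range_sub (fun s => gW T s (l - s))] at h2
    simpa using h2
  have anti : gW T 0 l = - gW T l 0 := by
    rw [gW, gW, ← Finset.sum_neg_distrib]
    exact Finset.sum_congr rfl fun v _ => by ring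
  have hg : wW T l * (Real.log (wW T l) - Real.log (wW T 0)) ≤ gW T l 0 := by
    have g := gibbs Finset.univ (aW T l) (aW T 0) (fun v _ => aW_nonneg _ _ _)
      (fun v _ => aW_nonneg _ _ _) (fun v _ _ => by simp [aW]) hw (wW_pos T 0 h)
    have e : gW T l 0 = - ∑ v, aW T l v * (Real.log (aW T 0 v) - Real.log (aW T l v)) := by
      rw [gW, ← Finset.sum_neg_distrib]
      exact Finset.sum_congr rfl fun v _ => by simp [aW]
    change _ ≤ wW T l * (Real.log (wW T 0) - Real.log (wW T l)) at g
    rw [e]; linarith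
  rw [anti] at tel
  have : wW T l * (2 * (Real.log (wW T l) - Real.log (wW T 0))) ≤
      wW T l * (l * (Real.log (wW T (l+2)) - Real.log (wW T l))) := by linarith
  exact le_of_mul_le_mul_left this hw

end Walks

section Upper

lemma convex_periodic (f : ℕ → ℝ) (p : ℕ) (hp : 1 ≤ p) (h0 : f 0 ≤ 0)
    (hc : ∀ j, 2 * f (j+1) ≤ f j + f (j+2)) (hper : ∀ j, f (j+p) ≤ f j) (j : ℕ) : f j ≤ 0 := by
  have step : ∀ j, f (j+1) ≤ f j := by
    intro j
    by_contra hlt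
    push Not at hlt
    have inc : ∀ i, f (j+i) < f (j+i+1) := by
      intro i
      induction i with
      | zero => exact hlt
      | succ i ih =>
        have := hc (j+i)
        rw [show j + (i+1) = j+i+1 by ring, show j+i+1+1 = j+i+2 by ring]
        linarith
    have : ∀ i, f j < f (j+i+1) := by
      intro i
      induction i with
      | zero => exact hlt
      | succ i ih => exact ih.trans (inc (i+1))
    have h1 := this (p-1)
    rw [show j + (p-1) + 1 = j + p by omega] at h1
    linarith [hper j]
  exact (antitone_nat_of_succ_le step (Nat.zero_le j)).trans h0

structure WalkLog (y : ℕ → ℝ) : Prop where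
  split : ∀ i j, y (i+j+1) ≤ y i + y j
  cs : ∀ i j, 2 * y (i+j) ≤ y (2*i) + y (2*j)
  ent : ∀ l : ℕ, 2 * (y l - y 0) ≤ l * (y (l+2) - y l)

namespace WalkLog

variable {y : ℕ → ℝ}

lemma es (h : WalkLog y) (l : ℕ) (j : ℕ) :
    ((l:ℝ) + 2 * j) * (y l - y 0) ≤ l * (y (l+2*j) - y 0) := by
  induction j with
  | zero => simp
  | succ j ih =>
    rcases Nat.eq_zero_or_pos l with rfl | hl
    · simp
    have := h.ent (l+2*j)
    rw [show l + 2*j + 2 = l + 2*(j+1) by ring] at this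
    push_cast at this ⊢
    have hl' : (0:ℝ) < l := by exact_mod_cast hl
    have hj : (0:ℝ) ≤ j := Nat.cast_nonneg j
    have h1 : ((l:ℝ) + 2*j+2) * (y (l+2*j) - y 0) ≤ (l+2*j) * (y (l+2*(j+1)) - y 0) := by linarith
    have h2 : ((l:ℝ) + 2*j+2) * (((l:ℝ) + 2 * j) * (y l - y 0)) ≤
      ((l:ℝ) + 2*j+2) * (l * (y (l+2*j) - y 0)) := mul_le_mul_of_nonneg_left ih (by positivity)
    have h3 : (l:ℝ) * (((l:ℝ) + 2*j+2) * (y (l+2*j) - y 0)) ≤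
      l * ((l+2*j) * (y (l+2*(j+1)) - y 0)) := mul_le_mul_of_nonneg_left h1 hl'.le
    have h4 : ((l:ℝ) + 2*j) * (((l:ℝ) + 2 * (j+1)) * (y l - y 0)) ≤
       ((l:ℝ) + 2*j) * (l * (y (l+2*(j+1)) - y 0)) := by linarith
    exact le_of_mul_le_mul_left h4 (by positivity)

lemma es' (h : WalkLog y) {l k : ℕ} (hlk : l ≤ k) (hpar : Even (k - l)) :
    (k:ℝ) * (y l - y 0) ≤ l * (y k - y 0) := by
  obtain ⟨j, hj⟩ := hpar
  obtain rfl : k = l + 2*j := by omega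
  have := h.es l j
  push_cast; exact this

lemma caseA (h : WalkLog y) {l k : ℕ} (hl : 1 ≤ l) (hlk : l < k) (hpar : Even k ∨ (Odd k ∧ Odd l)) :
    (k:ℝ) * (y l - y 0) ≤ l * (y k - y 0) := by
  by_cases hp : Even (k - l)
  · exact h.es' hlk.le hp
  have hk : Even k := by
    rcases hpar with h1 | ⟨h1, h2⟩
    · exact h1
    · exact absurd (Nat.Odd.sub_odd h1 h2) hp
  have hl' : ¬ Even l := fun hc => hp ((Nat.even_sub hlk.le).2 (by simp [hk, hc]))
  rw [Nat.not_even_iff_odd] at hl'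
  obtain ⟨i, rfl⟩ := hl'
  have h1 := h.es' (l := 2*i) (k := k) (by omega) ((Nat.even_sub (by omega)).2 (by simp [hk]))
  have h2 := h.es' (l := 2*(i+1)) (k := k) (by omega) ((Nat.even_sub (by omega)).2 (by simp [hk]))
  have h3 := h.cs i (i+1)
  rw [show i + (i+1) = 2*i+1 by ring] at h3
  have hk0 : (0:ℝ) ≤ k := Nat.cast_nonneg k
  have h4 := mul_le_mul_of_nonneg_left h3 hk0
  push_cast at *
  linarith

lemma conv (h : WalkLog y) (j : ℕ) : 2 * y (2*(j+1)) ≤ y (2*j) + y (2*(j+2)) := by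
  have := h.cs j (j+2)
  rwa [show j + (j+2) = 2*(j+1) by ring] at this

lemma split2 (h : WalkLog y) (k m : ℕ) : y (m + 2*(k+1)) ≤ y m + 2 * y k := by
  have h1 := h.split m k
  have h2 := h.split (m+k+1) k
  rw [show m + k + 1 + k + 1 = m + 2*(k+1) by ring] at h2
  linarith

lemma caseB (h : WalkLog y) {l k : ℕ} (hlE : Even l) :
    ((k:ℝ)+1) * (y l - y 0) ≤ l * y k := by
  obtain ⟨j, hj⟩ := hlE
  obtain rfl : l = 2*j := by omega
  have := convex_periodic (fun j => ((k:ℝ)+1) * (y (2*j) - y 0) - (2*j) * y k) (k+1) (by omega)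
    (by simp) (by
      intro j
      have h1 := mul_le_mul_of_nonneg_left (h.conv j) (show (0:ℝ) ≤ (k:ℝ)+1 by positivity)
      push_cast; linarith) (by
      intro j
      have h1 := mul_le_mul_of_nonneg_left (h.split2 k (2*j)) (show (0:ℝ) ≤ (k:ℝ)+1 by positivity)
      rw [← mul_add] at h1
      push_cast at h1 ⊢; linarith) j
  push_cast; linarith

lemma caseC (h : WalkLog y) {l k : ℕ} (hkl : k < l) (hk : Even k) :
    ((k:ℝ)+1) * y l ≤ (l+1) * y k := by
  obtain ⟨i, hi⟩ := hk
  obtain rfl : k = 2*i := by omega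
  have ev : ∀ j, ((2*i:ℕ):ℝ) * y (2*(i+j)) + y (2*(i+j)) ≤ (2*(i+j)+1) * y (2*i) := by
    intro j
    have := convex_periodic (fun j => (((2*i:ℕ):ℝ)+1) * y (2*(i+j)) - (2*(i+j)+1) * y (2*i)) (2*i+1) (by omega)
      (by simp) (by
        intro j
        have h1 := mul_le_mul_of_nonneg_left (h.conv (i+j)) (show (0:ℝ) ≤ ((2*i:ℕ):ℝ)+1 by positivity)
        rw [show i + (j+1) = i + j + 1 by ring, show i + (j+2) = i+j+2 by ring]
        push_cast at h1 ⊢; linarith) (by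
        intro j
        have h1 := mul_le_mul_of_nonneg_left (h.split2 (2*i) (2*(i+j))) (show (0:ℝ) ≤ ((2*i:ℕ):ℝ)+1 by positivity)
        rw [← mul_add, show i + j + (2*i+1) = i + (j + (2*i+1)) by ring] at h1
        push_cast at h1 ⊢; linarith) j
    linarith
  rcases Nat.even_or_odd' l with ⟨m, rfl | rfl⟩
  · obtain ⟨j, rfl⟩ : ∃ j, m = i + j := ⟨m - i, by omega⟩
    have := ev j
    push_cast at this ⊢; linarith
  · obtain ⟨j, rfl⟩ : ∃ j, m = i + j := ⟨m - i, by omega⟩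
    have h1 := ev j
    have h2 := ev (j+1)
    have h3 := mul_le_mul_of_nonneg_left (h.cs (i+j) (i+(j+1))) (show (0:ℝ) ≤ ((2*i:ℕ):ℝ)+1 by positivity)
    rw [show i + j + (i + (j+1)) = 2*(i+j)+1 by ring] at h3
    push_cast at *
    linarith

lemma splitMany (h : WalkLog y) (k a : ℕ) : y (k + a*(k+1)) ≤ (a+1) * y k := by
  induction a with
  | zero => simp
  | succ a ih =>
    have := h.split (k + a*(k+1)) k
    rw [show k + a*(k+1) + k + 1 = k + (a+1)*(k+1) by ring] at this
    push_cast; linarith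

lemma caseD (h : WalkLog y) {l k : ℕ} (hk : Odd k) (hl : Odd l) :
    ((k + (l/(k+1))*(k+1) : ℕ):ℝ) * (y l - y 0) ≤ l * (((l/(k+1) : ℕ) + 1) * y k - y 0) := by
  set a := l / (k+1) with ha
  have hle : l ≤ k + a*(k+1) := by
    have := Nat.div_add_mod l (k+1)
    have h2 := Nat.mod_lt l (show 0 < k+1 by omega)
    rw [← ha, mul_comm] at this
    omega
  have hodd : Odd (k + a*(k+1)) := by
    have : Even (k+1) := hk.add_one
    exact hk.add_even (this.mul_left a)
  have h1 := h.es' hle (Nat.Odd.sub_odd hodd hl)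
  refine h1.trans (mul_le_mul_of_nonneg_left ?_ (Nat.cast_nonneg l))
  linarith [h.splitMany k a]

end WalkLog

lemma walkLog {V : Type*} [Fintype V] (T : SimpleGraph V) {u v : V} (h : T.Adj u v) :
    WalkLog (fun m => Real.log (wW T m)) where
  split i j := by
    have hi := wW_pos T i h
    have hj := wW_pos T j h
    rw [← Real.log_mul hi.ne' hj.ne']
    exact Real.log_le_log (wW_pos T _ h) (wW_split T i j)
  cs i j := by
    have hi := wW_pos T (2*i) h
    have hj := wW_pos T (2*j) h
    rw [← Real.log_mul hi.ne' hj.ne']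
    have := Real.log_le_log (pow_pos (wW_pos T _ h) 2) (wW_cs T i j)
    rwa [Real.log_pow] at this
  ent l := entropy_two T h l

lemma dens_eq {V : Type*} [Fintype V] (T : SimpleGraph V) (m : ℕ) :
    homDensity (pathGraph (m+1)) T = wW T m / (Fintype.card V : ℝ) ^ (m+1) := by
  unfold homDensity
  rw [card_hom, Fintype.card_fin]

lemma mem_dom {k l : ℕ} (hl : 1 ≤ l) {c : ℝ} (hc : 0 < c)
    (H : ∀ y : ℕ → ℝ, WalkLog y → c * (y l - (l+1) * y 0) ≤ y k - (k+1) * y 0) :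
    c ∈ domSet (pathGraph (k+1)) (pathGraph (l+1)) := by
  refine ⟨hc.le, fun n hn T => ?_⟩
  rw [dens_eq, dens_eq]
  have hn' : (0:ℝ) < (Fintype.card (Fin n) : ℝ) := by simpa using hn
  by_cases hT : ∃ u v, T.Adj u v
  · obtain ⟨u, v, h⟩ := hT
    have := H _ (walkLog T h)
    have hp := fun m => wW_pos T m h
    have h1 : ∀ m : ℕ, Real.log (wW T m / (Fintype.card (Fin n) : ℝ)^(m+1)) =
        Real.log (wW T m) - (m+1) * Real.log (wW T 0) := by
      intro m
      rw [Real.log_div (hp m).ne' (by positivity), Real.log_pow, wW_zero]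
      push_cast; rfl
    have hpl := hp l
    have hpk := hp k
    rw [← Real.log_le_log_iff (by positivity) (by positivity), Real.log_rpow (by positivity), h1, h1]
    exact this
  · push Not at hT
    obtain ⟨l, rfl⟩ : ∃ m, l = m + 1 := ⟨l - 1, by omega⟩
    have : wW T (l+1) = 0 := by
      simp [wW, aW, adjI, hT]
    rw [this, zero_div, Real.zero_rpow hc.ne']
    have : 0 ≤ wW T k := Finset.sum_nonneg fun _ _ => aW_nonneg _ _ _
    positivity

end Upper

section Lower

lemma aW_comap {V W : Type*} [Fintype V] [Fintype W] (T : SimpleGraph V) (e : W ≃ V) (m : ℕ) (v : W) :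
    aW (T.comap e) m v = aW T m (e v) := by
  induction m generalizing v with
  | zero => simp [aW]
  | succ m ih =>
    rw [aW, aW, ← e.sum_comp]
    refine Finset.sum_congr rfl fun u _ => ?_
    rw [ih]
    rfl

lemma wW_comap {V W : Type*} [Fintype V] [Fintype W] (T : SimpleGraph V) (e : W ≃ V) (m : ℕ) :
    wW (T.comap e) m = wW T m := by
  rw [wW, wW, ← e.sum_comp]
  exact Finset.sum_congr rfl fun u _ => aW_comap T e m u

lemma dom_apply {k l : ℕ} {c : ℝ} (hc : c ∈ domSet (pathGraph (k+1)) (pathGraph (l+1)))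
    {V : Type*} [Fintype V] [Nonempty V] (T : SimpleGraph V) :
    (wW T l / (Fintype.card V : ℝ) ^ (l+1)) ^ c ≤ wW T k / (Fintype.card V : ℝ) ^ (k+1) := by
  have := hc.2 (Fintype.card V) Fintype.card_pos (T.comap (Fintype.equivFin V).symm)
  rw [dens_eq, dens_eq, wW_comap, wW_comap, Fintype.card_fin] at this
  exact this

lemma lower_family {b g : ℕ} {c C₁ C₂ : ℝ} (hc : 0 ≤ c) (h1 : 0 < C₁) 
    (H : ∀ B : ℕ, 2 ≤ B → ∃ s t : ℝ, s ^ c ≤ t ∧ C₁ ≤ s * B ^ b ∧ t * B ^ g ≤ C₂) :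
    (g:ℝ) ≤ c * b := by
  by_contra hlt
  push Not at hlt
  have ht := (tendsto_rpow_atTop (show 0 < (g:ℝ) - c * b by linarith)).comp
    (tendsto_natCast_atTop_atTop (R := ℝ))
  obtain ⟨B, hB, hB2⟩ := ((ht.eventually_gt_atTop (C₂ / C₁ ^ c)).and
    (Filter.eventually_ge_atTop 2)).exists
  obtain ⟨s, t, hst, hs, htt⟩ := H B hB2
  have hBp : (0:ℝ) < B := by exact_mod_cast (by omega : 0 < B)
  have hC : 0 < C₁ ^ c := Real.rpow_pos_of_pos h1 c
  simp only [Function.comp] at hB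
  rw [div_lt_iff₀ hC, Real.rpow_sub hBp, Real.rpow_natCast, mul_comm c, Real.rpow_mul hBp.le,
    Real.rpow_natCast] at hB
  have hBb : 0 < ((B:ℝ)^b) ^ c := Real.rpow_pos_of_pos (by positivity) c
  have hs0 : 0 < s := by
    by_contra hn
    push Not at hn
    have : s * (B:ℝ)^b ≤ 0 := mul_nonpos_of_nonpos_of_nonneg hn (by positivity)
    linarith
  have h2 : C₁ ^ c ≤ s ^ c * ((B:ℝ)^b)^c := by
    rw [← Real.mul_rpow hs0.le (by positivity)]
    exact Real.rpow_le_rpow h1.le hs hc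
  have h3 : (B:ℝ)^g / ((B:ℝ)^b)^c * C₁ ^ c ≤ (B:ℝ)^g / ((B:ℝ)^b)^c * (s ^ c * ((B:ℝ)^b)^c) :=
    mul_le_mul_of_nonneg_left h2 (by positivity)
  have h4 : (B:ℝ)^g / ((B:ℝ)^b)^c * (s ^ c * ((B:ℝ)^b)^c) = s ^ c * (B:ℝ)^g := by
    field_simp
  have h5 : s ^ c * (B:ℝ)^g ≤ t * (B:ℝ)^g := mul_le_mul_of_nonneg_right hst (by positivity)
  linarith

lemma lowerA {k l : ℕ} {c : ℝ} (hc : c ∈ domSet (pathGraph (k+1)) (pathGraph (l+1))) :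
    (k:ℝ) ≤ c * l := by
  have ha : ∀ m v, aW (⊤ : SimpleGraph (Fin 2)) m v = 1 := by
    intro m
    induction m with
    | zero => simp [aW]
    | succ m ih =>
      intro v
      rw [aW]
      simp only [ih, Fin.sum_univ_two, adjI]
      fin_cases v <;> simp
  have hw : ∀ m, wW (⊤ : SimpleGraph (Fin 2)) m = 2 := by
    intro m; simp [wW, ha]
  have := dom_apply hc (⊤ : SimpleGraph (Fin 2))
  rw [hw, hw, Fintype.card_fin] at this
  have h1 : ∀ m : ℕ, (2:ℝ) / ((2:ℕ):ℝ)^(m+1) = (2:ℝ) ^ (-(m:ℝ)) := by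
    intro m
    rw [Real.rpow_neg (by norm_num), Real.rpow_natCast, pow_succ]
    push_cast
    field_simp
  rw [h1, h1, ← Real.rpow_mul (by norm_num), Real.rpow_le_rpow_left_iff (by norm_num)] at this
  linarith

lemma lowerB {k l : ℕ} {c : ℝ} (hk : Odd k) (hl : Even l)
    (hc : c ∈ domSet (pathGraph (k+1)) (pathGraph (l+1))) :
    (k:ℝ) + 1 ≤ c * l := by
  obtain ⟨i, rfl⟩ := hk
  obtain ⟨j, hj⟩ := hl
  obtain rfl : l = 2*j := by omega
  suffices h : ((i+1:ℕ):ℝ) ≤ c * j by push_cast at *; linarith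
  refine lower_family (C₁ := 1 / 4^j) (C₂ := 2) hc.1 (by positivity) fun B hB => ?_
  let T := completeBipartiteGraph (Fin 1) (Fin B)
  have hB0 : (0:ℝ) < B := by exact_mod_cast (by omega : 0 < B)
  have hev : ∀ m, (∀ v, aW T (2*m) v = (B:ℝ)^m) := by
    intro m
    induction m with
    | zero => simp [aW]
    | succ m ih =>
      intro v
      rw [show 2*(m+1) = 2*m+1+1 by ring]
      simp only [aW, ih, Fintype.sum_sum_type]
      rcases v with v | v <;> simp [adjI, T, pow_succ] <;> ring
  have hodd : ∀ m, wW T (2*m+1) = 2 * (B:ℝ)^(m+1) := by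
    intro m
    rw [wW]
    simp only [aW, hev, Fintype.sum_sum_type]
    simp [adjI, T, pow_succ]; ring
  have hcard : (Fintype.card (Fin 1 ⊕ Fin B) : ℝ) = B + 1 := by simp; ring
  have hw : wW T (2*j) = (B+1) * (B:ℝ)^j := by
    simp only [wW, hev, Finset.sum_const, Finset.card_univ, nsmul_eq_mul, hcard]
  refine ⟨_, _, dom_apply hc T, ?_, ?_⟩
  · rw [hw, hcard]
    have h1 : ((B:ℝ)+1) * B^j / (B+1)^(2*j+1) * B^j = (B/(B+1))^(2*j) := by
      rw [pow_succ, div_pow, pow_mul (B:ℝ), sq, mul_pow]; field_simp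
    rw [h1, pow_mul]
    have h2 : (1:ℝ)/2 ≤ B/(B+1) := by
      rw [div_le_div_iff₀ (by norm_num) (by positivity)]
      have : (2:ℝ) ≤ B := by exact_mod_cast hB
      linarith
    have h3 : (1:ℝ)/4 ≤ (B/(B+1))^2 := by
      have := pow_le_pow_left₀ (by norm_num) h2 2
      norm_num at this ⊢; linarith
    have := pow_le_pow_left₀ (by norm_num) h3 j
    rwa [div_pow, one_pow] at this
  · rw [hodd, hcard, div_mul_eq_mul_div, div_le_iff₀ (by positivity)]
    have h1 : (B:ℝ)^(i+1) * B^(i+1) ≤ (B+1)^(2*i+1+1) := by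
      rw [← pow_add, show 2*i+1+1 = i+1+(i+1) by ring]
      exact pow_le_pow_left₀ hB0.le (by linarith) _
    linarith

lemma lowerC {k l : ℕ} {c : ℝ} (hk : 1 ≤ k)
    (hc : c ∈ domSet (pathGraph (k+1)) (pathGraph (l+1))) :
    (k:ℝ) + 1 ≤ c * (l + 1) := by
  suffices h : ((k+1:ℕ):ℝ) ≤ c * (l+1:ℕ) by push_cast at *; linarith
  refine lower_family (C₁ := 2 / 2^(l+1)) (C₂ := 2) hc.1 (by positivity) fun B hB => ?_
  let T : SimpleGraph (Fin 2 ⊕ Fin B) := (⊤ : SimpleGraph (Fin 2)) ⊕g (⊥ : SimpleGraph (Fin B))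
  have hB2 : (2:ℝ) ≤ B := by exact_mod_cast hB
  have ha : ∀ m v, aW T m (Sum.inl v) = 1 := by
    intro m
    induction m with
    | zero => simp [aW]
    | succ m ih =>
      intro v
      rw [aW]
      simp only [ih, Fintype.sum_sum_type, adjI, Fin.sum_univ_two]
      fin_cases v <;> simp [T]
  have hb : ∀ m v, aW T (m+1) (Sum.inr v) = 0 := by
    intro m v
    rw [aW]
    simp [Fintype.sum_sum_type, adjI, T]
  have hwl : 2 ≤ wW T l := by
    rw [wW]
    simp only [Fintype.sum_sum_type, ha]
    have : 0 ≤ ∑ x, aW T l (Sum.inr x) := Finset.sum_nonneg fun _ _ => aW_nonneg _ _ _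
    simp; linarith
  have hwk : wW T k = 2 := by
    obtain ⟨k, rfl⟩ : ∃ m, k = m + 1 := ⟨k - 1, by omega⟩
    rw [wW]
    simp [Fintype.sum_sum_type, ha, hb]
  have hcard : (Fintype.card (Fin 2 ⊕ Fin B) : ℝ) = B + 2 := by simp; ring
  refine ⟨_, _, dom_apply hc T, ?_, ?_⟩
  · rw [hcard, div_mul_eq_mul_div, div_le_div_iff₀ (by positivity) (by positivity)]
    have h1 : ((B:ℝ)+2)^(l+1) ≤ B^(l+1) * 2^(l+1) := by
      rw [← mul_pow]
      exact pow_le_pow_left₀ (by positivity) (by linarith) _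
    have h2 : 2 * ((B:ℝ)^(l+1) * 2^(l+1)) ≤ wW T l * (B^(l+1) * 2^(l+1)) :=
      mul_le_mul_of_nonneg_right hwl (by positivity)
    linarith
  · rw [hwk, hcard, div_mul_eq_mul_div, div_le_iff₀ (by positivity)]
    have : (B:ℝ)^(k+1) ≤ (B+2)^(k+1) := pow_le_pow_left₀ (by positivity) (by linarith) _
    linarith

end Lower

section LowerD

/-- path blow-up used for the odd/odd lower bound -/
def blow (l A B : ℕ) (X : ℕ → ℕ) : SimpleGraph (Fin (l+1) × Fin (B^(2*A))) where
  Adj p q := ((p.1:ℕ) + 1 = q.1 ∨ (q.1:ℕ) + 1 = p.1) ∧ (p.2:ℕ) < B^(2 * X p.1) ∧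
    (q.2:ℕ) < B^(2 * X q.1) ∧ (p.2:ℕ) % B^(X p.1 + X q.1 - A) = (q.2:ℕ) % B^(X p.1 + X q.1 - A)
  symm := ⟨fun p q h => by
    obtain ⟨h1, h2, h3, h4⟩ := h
    refine ⟨h1.symm, h3, h2, ?_⟩
    rw [add_comm (X q.1), h4]⟩
  loopless := ⟨fun p h => by
    obtain ⟨h1, -⟩ := h
    omega⟩

open Classical in
/-- weighted walk counts on the path pattern -/
noncomputable def beta (l B : ℕ) (X : ℕ → ℕ) : ℕ → Fin (l+1) → ℝ
  | 0, i => (B:ℝ)^(X i)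
  | m+1, i => ∑ j : Fin (l+1), if ((i:ℕ) + 1 = j ∨ (j:ℕ) + 1 = i) then beta l B X m j else 0

lemma count_res (M S g u : ℕ) (hS : S ≤ M) (hg : 0 < g) (hd : g ∣ S) :
    (∑ v : Fin M, if ((v:ℕ) < S ∧ u % g = (v:ℕ) % g) then (1:ℝ) else 0) = ((S / g : ℕ) : ℝ) := by
  have h1 : (∑ v : Fin M, if ((v:ℕ) < S ∧ u % g = (v:ℕ) % g) then (1:ℝ) else 0) =
      ∑ v ∈ Finset.range M, if (v < S ∧ u % g = v % g) then (1:ℝ) else 0 :=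
    Fin.sum_univ_eq_sum_range (fun v => if (v < S ∧ u % g = v % g) then (1:ℝ) else 0) M
  rw [h1]
  have h2 := Nat.count_modEq_card S hg u
  rw [Nat.mod_eq_zero_of_dvd hd] at h2
  simp only [Nat.not_lt_zero, if_false, add_zero] at h2
  rw [← h2, Nat.count_eq_card_filter_range, Finset.sum_boole]
  refine congrArg (fun s : Finset ℕ => (s.card : ℝ)) ?_
  refine Finset.ext fun v => ?_
  rw [Finset.mem_filter, Finset.mem_filter, Finset.mem_range, Finset.mem_range, Nat.ModEq]
  constructor
  · rintro ⟨a, b, c⟩; exact ⟨b, c.symm⟩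
  · rintro ⟨a, b⟩; exact ⟨by omega, a, b.symm⟩

variable {l A B : ℕ} {X : ℕ → ℕ}

lemma blow_aW (hB : 2 ≤ B) (hXA : ∀ i, i ≤ l → X i ≤ A)
    (hX2 : ∀ i, i < l → A ≤ X i + X (i+1)) (m : ℕ) (i : Fin (l+1)) (u : Fin (B^(2*A)))
    (hu : (u:ℕ) < B^(2 * X i)) :
    aW (blow l A B X) m (i, u) * (B:ℝ)^(X i) = (B:ℝ)^(m*A) * beta l B X m i := by
  classical
  induction m generalizing i u with
  | zero => simp [aW, beta]
  | succ m ih =>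
    rw [aW, beta, Fintype.sum_prod_type, Finset.sum_mul, Finset.mul_sum]
    refine Finset.sum_congr rfl fun j _ => ?_
    have hB0 : (B:ℝ) ≠ 0 := by
      have : B ≠ 0 := by omega
      exact_mod_cast this
    by_cases hij : ((i:ℕ) + 1 = j ∨ (j:ℕ) + 1 = i)
    · have hi := hXA i (by omega)
      have hj := hXA j (by omega)
      have hsum : A ≤ X i + X j := by
        rcases hij with h | h
        · have := hX2 i (by omega)
          rwa [h] at this
        · have := hX2 j (by omega)
          rw [h] at this; omega
      rw [if_pos hij]
      have h1 : ∀ v : Fin (B^(2*A)), adjI (blow l A B X) (i,u) (j,v) * aW (blow l A B X) m (j,v) =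
          (if ((v:ℕ) < B^(2 * X j) ∧ (u:ℕ) % B^(X i + X j - A) = (v:ℕ) % B^(X i + X j - A))
            then (1:ℝ) else 0) * ((B:ℝ)^(m*A) * beta l B X m j / (B:ℝ)^(X j)) := by
        intro v
        by_cases hv : (v:ℕ) < B^(2 * X j)
        · rw [← ih j v hv, mul_div_cancel_right₀ _ (pow_ne_zero _ hB0)]
          congr 1
          simp [adjI, blow, hij, hu, hv]
        · simp [adjI, blow, hv]
      rw [Finset.sum_congr rfl fun v _ => h1 v, ← Finset.sum_mul, count_res _ _ _ _
        (Nat.pow_le_pow_right (by omega) (by omega)) (Nat.pow_pos (by omega))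
        (pow_dvd_pow _ (by omega)), Nat.pow_div (by omega) (by omega)]
      push_cast
      rw [div_eq_mul_inv]
      have e : (B:ℝ)^(2 * X j - (X i + X j - A)) * (B:ℝ)^(X i) = B^A * B^(X j) := by
        rw [← pow_add, ← pow_add]; congr 1; omega
      have e2 : (B:ℝ)^(X j) * ((B:ℝ)^(X j))⁻¹ = 1 := mul_inv_cancel₀ (pow_ne_zero _ hB0)
      calc _ = ((B:ℝ)^(2 * X j - (X i + X j - A)) * (B:ℝ)^(X i)) * ((B:ℝ)^(X j))⁻¹ *
            ((B:ℝ)^(m*A) * beta l B X m j) := by ring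
        _ = (B^A * (B:ℝ)^(m*A)) * beta l B X m j * ((B:ℝ)^(X j) * ((B:ℝ)^(X j))⁻¹) := by
            rw [e]; ring
        _ = _ := by rw [e2, mul_one, ← pow_add]; congr 2; ring
    · rw [if_neg hij, mul_zero]
      have : ∀ v, adjI (blow l A B X) (i,u) (j,v) = 0 := by
        intro v
        simp only [adjI, blow, hij, false_and, if_false]
      simp [this]

lemma blow_wW (hB : 2 ≤ B) (hXA : ∀ i, i ≤ l → X i ≤ A)
    (hX2 : ∀ i, i < l → A ≤ X i + X (i+1)) (m : ℕ) (hm : 1 ≤ m) :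
    wW (blow l A B X) m = (B:ℝ)^(m*A) * ∑ i : Fin (l+1), (B:ℝ)^(X i) * beta l B X m i := by
  classical
  have hB0 : (B:ℝ) ≠ 0 := by
    have : B ≠ 0 := by omega
    exact_mod_cast this
  rw [wW, Fintype.sum_prod_type, Finset.mul_sum]
  refine Finset.sum_congr rfl fun i _ => ?_
  have h1 : ∀ u : Fin (B^(2*A)), aW (blow l A B X) m (i,u) =
      (if ((u:ℕ) < B^(2 * X i) ∧ 0 % 1 = (u:ℕ) % 1) then (1:ℝ) else 0) *
        ((B:ℝ)^(m*A) * beta l B X m i / (B:ℝ)^(X i)) := by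
    intro u
    by_cases hu : (u:ℕ) < B^(2 * X i)
    · rw [← blow_aW hB hXA hX2 m i u hu, mul_div_cancel_right₀ _ (pow_ne_zero _ hB0)]
      simp [hu, Nat.mod_one]
    · obtain ⟨m, rfl⟩ : ∃ t, m = t + 1 := ⟨m - 1, by omega⟩
      rw [aW]
      simp [adjI, blow, hu]
  rw [Finset.sum_congr rfl fun v _ => h1 v, ← Finset.sum_mul, count_res _ _ _ _
    (Nat.pow_le_pow_right (by omega) (by have := hXA i (by omega); omega)) Nat.one_pos (one_dvd _)]
  rw [Nat.div_one]
  push_cast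
  rw [two_mul, pow_add]
  field_simp

lemma beta_upper (hB : 2 ≤ B) (e m : ℕ) (i : Fin (l+1))
    (h : ∀ j : ℕ, j ≤ l → (i:ℕ) ≤ j + m → j ≤ i + m → (i + j + m) % 2 = 0 → X j ≤ e) :
    beta l B X m i ≤ ((l:ℝ)+1)^m * (B:ℝ)^e := by
  have hB1 : (1:ℝ) ≤ B := by exact_mod_cast (by omega : 1 ≤ B)
  induction m generalizing i with
  | zero =>
    simp only [beta, pow_zero, one_mul]
    exact pow_le_pow_right₀ hB1 (h i (by omega) (by omega) (by omega) (by omega))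
  | succ m ih =>
    rw [beta]
    calc _ ≤ ∑ j : Fin (l+1), ((l:ℝ)+1)^m * (B:ℝ)^e := by
          refine Finset.sum_le_sum fun j _ => ?_
          split_ifs with hij
          · exact ih j fun j' h1 h2 h3 h4 => h j' h1 (by omega) (by omega) (by omega)
          · positivity
      _ = _ := by
          simp [pow_succ]; ring

lemma beta_nonneg (m : ℕ) (i : Fin (l+1)) : 0 ≤ beta l B X m i := by
  induction m generalizing i with
  | zero => simp only [beta]; positivity
  | succ m ih =>
    rw [beta]
    refine Finset.sum_nonneg fun j _ => ?_
    split_ifs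
    · exact ih j
    · exact le_rfl

lemma beta_lower (m : ℕ) (i : Fin (l+1)) (h : (i:ℕ) + m = l) :
    (B:ℝ)^(X l) ≤ beta l B X m i := by
  classical
  induction m generalizing i with
  | zero =>
    simp only [beta]
    rw [show (i:ℕ) = l by omega]
  | succ m ih =>
    rw [beta]
    have hlt : (i:ℕ) + 1 < l + 1 := by omega
    have h1 := ih ⟨i + 1, hlt⟩ (by simp; omega)
    refine h1.trans ?_
    have := Finset.single_le_sum (f := fun j : Fin (l+1) =>
      if ((i:ℕ) + 1 = j ∨ (j:ℕ) + 1 = i) then beta l B X m j else 0) (fun j _ => by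
        split_ifs
        · exact beta_nonneg _ _
        · exact le_rfl) (Finset.mem_univ ⟨(i:ℕ) + 1, hlt⟩)
    simpa using this

lemma lowerD_aux {k l A : ℕ} {c : ℝ} (X : ℕ → ℕ) (hk : 1 ≤ k) (hl : 1 ≤ l) (hA : 1 ≤ A)
    (hXA : ∀ i, i ≤ l → X i ≤ A) (hX2 : ∀ i, i < l → A ≤ X i + X (i+1))
    (hX0 : X 0 = A) (hXl : X l = A)
    (hX3 : ∀ i j, i ≤ l → j ≤ l → i ≤ j + k → j ≤ i + k → (i + j + k) % 2 = 0 → X i + X j ≤ A + 1)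
    (hc : c ∈ domSet (pathGraph (k+1)) (pathGraph (l+1))) :
    ((k * A + (A - 1) : ℕ) : ℝ) ≤ c * (A * l : ℕ) := by
  refine lower_family (C₁ := 1 / ((l:ℝ)+1)^(l+1)) (C₂ := 1) hc.1 (by positivity) fun B hB => ?_
  have hB0 : (0:ℝ) < B := by exact_mod_cast (by omega : 0 < B)
  have hne : 0 < B^(2*A) := Nat.pow_pos (by omega)
  have : Nonempty (Fin (l+1) × Fin (B^(2*A))) := ⟨(0, ⟨0, hne⟩)⟩
  have hcard : (Fintype.card (Fin (l+1) × Fin (B^(2*A))) : ℝ) = ((l:ℝ)+1) * (B:ℝ)^(2*A) := by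
    simp
  refine ⟨_, _, dom_apply hc (blow l A B X), ?_, ?_⟩
  · rw [hcard, blow_wW hB hXA hX2 l hl]
    have h1 : (B:ℝ)^A * B^A ≤ ∑ i : Fin (l+1), (B:ℝ)^(X i) * beta l B X l i := by
      have h2 := Finset.single_le_sum (f := fun i : Fin (l+1) => (B:ℝ)^(X i) * beta l B X l i)
        (fun i _ => mul_nonneg (by positivity) (beta_nonneg _ _)) (Finset.mem_univ 0)
      refine le_trans ?_ h2
      have h3 := beta_lower (B := B) (X := X) l (0 : Fin (l+1)) (by simp)
      rw [hXl] at h3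
      simp only [Fin.val_zero, hX0]
      exact mul_le_mul_of_nonneg_left h3 (by positivity)
    rw [div_mul_eq_mul_div, div_le_div_iff₀ (by positivity) (by positivity), one_mul, mul_pow]
    have e : ((B:ℝ)^(2*A))^(l+1) = (B:ℝ)^(l*A) * (B^A * B^A) * B^(A*l) := by
      simp only [← pow_mul, ← pow_add]; congr 1; ring
    rw [e, mul_comm]
    gcongr
  · rw [hcard, blow_wW hB hXA hX2 k hk, div_mul_eq_mul_div, div_le_iff₀ (by positivity), one_mul,
      mul_pow]
    have h1 : ∑ i : Fin (l+1), (B:ℝ)^(X i) * beta l B X k i ≤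
        ∑ i : Fin (l+1), ((l:ℝ)+1)^k * (B:ℝ)^(A+1) := by
      refine Finset.sum_le_sum fun i _ => ?_
      have hi := hXA i (by omega)
      have := beta_upper (X := X) hB (A + 1 - X i) k i (fun j h1 h2 h3 h4 => by
        have := hX3 i j (by omega) h1 h2 h3 h4
        omega)
      calc _ ≤ (B:ℝ)^(X i) * (((l:ℝ)+1)^k * (B:ℝ)^(A + 1 - X i)) :=
            mul_le_mul_of_nonneg_left this (by positivity)
        _ = ((l:ℝ)+1)^k * ((B:ℝ)^(X i) * (B:ℝ)^(A + 1 - X i)) := by ring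
        _ = _ := by rw [← pow_add]; congr 2; omega
    have h2 : ∑ i : Fin (l+1), ((l:ℝ)+1)^k * (B:ℝ)^(A+1) = ((l:ℝ)+1)^(k+1) * (B:ℝ)^(A+1) := by
      simp [pow_succ]; ring
    rw [h2] at h1
    have e : ((B:ℝ)^(2*A))^(k+1) = (B:ℝ)^(k*A) * B^(A+1) * B^(k*A+(A-1)) := by
      simp only [← pow_mul, ← pow_add]; congr 1
      obtain ⟨a, rfl⟩ : ∃ a, A = a + 1 := ⟨A - 1, by omega⟩
      simp only [Nat.add_sub_cancel]; ring
    rw [e]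
    calc _ ≤ (B:ℝ)^(k*A) * (((l:ℝ)+1)^(k+1) * (B:ℝ)^(A+1)) * B^(k*A+(A-1)) := by gcongr
      _ = _ := by ring

/-- class exponents -/
def XX (l a i : ℕ) : ℕ :=
  if i % 2 = 0 then a + 1 - (a * i + l) / (l+1) else a + 1 - (a * (l - i) + l) / (l+1)

lemma ceil_le {a l i : ℕ} (hi : i ≤ l) : (a * i + l) / (l+1) ≤ a := by
  rw [← Nat.lt_add_one_iff, Nat.div_lt_iff_lt_mul (by omega)]
  nlinarith

lemma ceil_sum_ge {a k l i j : ℕ} (hak : a * (k+1) ≤ l) (hj : j ≤ l) (h : j ≤ i + k) :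
    a ≤ (a * i + l) / (l+1) + (a * (l - j) + l) / (l+1) := by
  have h1 := Nat.lt_div_mul_add (a := a * i + l) (b := l+1) (by omega)
  have h2 := Nat.lt_div_mul_add (a := a * (l - j) + l) (b := l+1) (by omega)
  set p := (a * i + l) / (l+1)
  set q := (a * (l - j) + l) / (l+1)
  by_contra hc
  push Not at hc
  obtain ⟨d, rfl⟩ : ∃ d, l = j + d := ⟨l - j, by omega⟩
  rw [Nat.add_sub_cancel_left] at h2
  have h3 : (p + q + 1) * (j + d + 1) ≤ a * (j + d + 1) := Nat.mul_le_mul_right _ hc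
  have h4 : a * j ≤ a * (i + k) := Nat.mul_le_mul_left _ h
  nlinarith

lemma ceil_sum_le {a l i j : ℕ} (hj : j ≤ l) (h : i ≤ j + 1) :
    (a * i + l) / (l+1) + (a * (l - j) + l) / (l+1) ≤ a + 1 := by
  have h1 := Nat.div_mul_le_self (a * i + l) (l+1)
  have h2 := Nat.div_mul_le_self (a * (l - j) + l) (l+1)
  set p := (a * i + l) / (l+1)
  set q := (a * (l - j) + l) / (l+1)
  by_contra hc
  push Not at hc
  obtain ⟨d, rfl⟩ : ∃ d, l = j + d := ⟨l - j, by omega⟩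
  rw [Nat.add_sub_cancel_left] at h2
  have h3 : (a + 2) * (j + d + 1) ≤ (p + q) * (j + d + 1) := Nat.mul_le_mul_right _ hc
  have h4 : a * i ≤ a * (j + 1) := Nat.mul_le_mul_left _ h
  nlinarith

lemma lowerD {k l : ℕ} {c : ℝ} (hk : Odd k) (hl : Odd l) (hkl : k < l)
    (hc : c ∈ domSet (pathGraph (k+1)) (pathGraph (l+1))) :
    ((k + (l/(k+1))*(k+1) : ℕ):ℝ) ≤ c * ((((l/(k+1) : ℕ):ℝ) + 1) * l) := by
  set a := l / (k+1) with ha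
  have ha1 : 1 ≤ a := (Nat.one_le_div_iff (by omega)).2 hkl
  have hak : a * (k+1) ≤ l := Nat.div_mul_le_self l (k+1)
  have hk2 : k % 2 = 1 := Nat.odd_iff.1 hk
  have hl2 : l % 2 = 1 := Nat.odd_iff.1 hl
  have hz : l / (l+1) = 0 := Nat.div_eq_of_lt (by omega)
  have main := lowerD_aux (A := a + 1) (XX l a) hk.pos hl.pos (by omega)
    (fun i hi => by unfold XX; split_ifs <;> exact Nat.sub_le _ _)
    (fun i hi => by
      unfold XX
      rcases Nat.mod_two_eq_zero_or_one i with h | h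
      · rw [if_pos h, if_neg (by omega)]
        have := ceil_sum_le (a := a) (l := l) (i := i) (j := i+1) (by omega) (by omega)
        omega
      · rw [if_neg (by omega), if_pos (by omega)]
        have := ceil_sum_le (a := a) (l := l) (i := i+1) (j := i) (by omega) (by omega)
        omega)
    (by simp [XX, hz]) (by simp [XX, hl2, hz])
    (fun i j hi hj h1 h2 h3 => by
      unfold XX
      rcases Nat.mod_two_eq_zero_or_one i with h | h
      · rw [if_pos h, if_neg (by omega)]
        have := ceil_sum_ge (i := i) (j := j) hak hj h2
        have := ceil_le (a := a) hi
        have := ceil_le (a := a) (show l - j ≤ l by omega)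
        omega
      · rw [if_neg (by omega), if_pos (by omega)]
        have := ceil_sum_ge (i := j) (j := i) hak hi h1
        have := ceil_le (a := a) hj
        have := ceil_le (a := a) (show l - i ≤ l by omega)
        omega)
    hc
  rw [show k * (a+1) + (a + 1 - 1) = k + a*(k+1) by rw [Nat.add_sub_cancel]; ring] at main
  push_cast at main ⊢
  exact main

end LowerD

theorem stmt_6 (k l : ℕ) (hk : 1 ≤ k) (hl : 1 ≤ l) :
    (l < k → (Even k ∨ (Odd k ∧ Odd l)) →
      domExp (pathGraph (k+1)) (pathGraph (l+1)) = (k:ℝ)/(l:ℝ)) ∧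
    (Odd k → Even l →
      domExp (pathGraph (k+1)) (pathGraph (l+1)) = ((k:ℝ)+1)/(l:ℝ)) ∧
    (k < l → Even k →
      domExp (pathGraph (k+1)) (pathGraph (l+1)) = ((k:ℝ)+1)/((l:ℝ)+1)) ∧
    (k < l → Odd k → Odd l →
      domExp (pathGraph (k+1)) (pathGraph (l+1)) =
        ((k:ℝ) + (l:ℝ) - ((l % (k+1) : ℕ) : ℝ)) / ((((l / (k+1) : ℕ) : ℝ) + 1) * (l:ℝ))) := by

  have hk0 : (0:ℝ) < k := by exact_mod_cast hk
  have hl0 : (0:ℝ) < l := by exact_mod_cast hl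
  refine ⟨fun hlk hpar => ?_, fun hko hle => ?_, fun hkl hke => ?_, fun hkl hko hlo => ?_⟩
  · refine IsLeast.csInf_eq ⟨mem_dom hl (by positivity) fun y hy => ?_, fun c hc => ?_⟩
    · have := hy.caseA hl hlk hpar
      rw [div_mul_eq_mul_div, div_le_iff₀ hl0]
      linarith
    · rw [div_le_iff₀ hl0]; exact lowerA hc
  · refine IsLeast.csInf_eq ⟨mem_dom hl (by positivity) fun y hy => ?_, fun c hc => ?_⟩
    · have := hy.caseB (k := k) hle
      rw [div_mul_eq_mul_div, div_le_iff₀ hl0]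
      linarith
    · rw [div_le_iff₀ hl0]; exact lowerB hko hle hc
  · refine IsLeast.csInf_eq ⟨mem_dom hl (by positivity) fun y hy => ?_, fun c hc => ?_⟩
    · have := hy.caseC hkl hke
      rw [div_mul_eq_mul_div, div_le_iff₀ (by positivity)]
      linarith
    · rw [div_le_iff₀ (by positivity)]; exact lowerC hk hc
  · have hN : (k:ℝ) + l - ((l % (k+1) : ℕ) : ℝ) = ((k + (l/(k+1))*(k+1) : ℕ):ℝ) := by
      have h1 : (k+1) * (l/(k+1)) + l % (k+1) = l := Nat.div_add_mod l (k+1)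
      have h2 : (((k+1) * (l/(k+1)) + l % (k+1) : ℕ):ℝ) = (l:ℝ) := by rw [h1]
      push_cast at h2 ⊢
      linarith
    rw [hN]
    have hNpos : (0:ℝ) < ((k + (l/(k+1))*(k+1) : ℕ):ℝ) := by
      exact_mod_cast (by omega : 0 < k + (l/(k+1))*(k+1))
    refine IsLeast.csInf_eq ⟨mem_dom hl (by positivity) fun y hy => ?_, fun c hc => ?_⟩
    · have := hy.caseD (k := k) hko hlo
      rw [div_mul_eq_mul_div, div_le_iff₀ (by positivity)]
      push_cast at this ⊢
      linarith
    · rw [div_le_iff₀ (by positivity)]; exact lowerD hko hlo hkl hc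
end
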